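/- arXiv:1702.03787 — 3 statements merged into one kernel-verified Lean document; each statement's English description precedes it below -/
import Mathlib

section
/- For every analytic quasi-order R on a standard Borel space X there is a Borel subset B of X_Gp, invariant under the isomorphism relation ≅_Gp, such that the restriction of the embeddability relation ⊑_Gp to B is Borel bi-reducible with R. -/
/-- A subset of a standard Borel space is analytic iff it is empty or the range of a
Borel-measurable function from the Baire space `ℕ → ℕ`. -/
def IsAnalyticS {X : Type*} [MeasurableSpace X] (S : Set X) : Prop :=
  S = ∅ ∨ ∃ f : (ℕ → ℕ) → X, Measurable f ∧ Set.range f = S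

/-- A binary relation is analytic if it is analytic as a subset of the product. -/
def IsAnalyticRel {X : Type*} [MeasurableSpace X] (R : X → X → Prop) : Prop :=
  IsAnalyticS {p : X × X | R p.1 p.2}

/-- A quasi-order is a reflexive and transitive binary relation. -/
def IsQuasiOrder {X : Type*} (R : X → X → Prop) : Prop :=
  Reflexive R ∧ Transitive R

/-- Borel reducibility of binary relations. -/
def BorelReducible {X Y : Type*} [MeasurableSpace X] [MeasurableSpace Y]
    (R : X → X → Prop) (S : Y → Y → Prop) : Prop :=
  ∃ f : X → Y, Measurable f ∧ ∀ x x', R x x' ↔ S (f x) (f x')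

/-- Borel bi-reducibility of binary relations. -/
def BorelBireducible {X Y : Type*} [MeasurableSpace X] [MeasurableSpace Y]
    (R : X → X → Prop) (S : Y → Y → Prop) : Prop :=
  BorelReducible R S ∧ BorelReducible S R

/-- `m : ℕ × ℕ → ℕ` is a group multiplication on `ℕ`. -/
def IsGroupOp (m : ℕ × ℕ → ℕ) : Prop :=
  (∀ a b c, m (m (a, b), c) = m (a, m (b, c))) ∧
  ∃ e, (∀ a, m (e, a) = a ∧ m (a, e) = a) ∧ ∀ a, ∃ b, m (a, b) = e ∧ m (b, a) = e

/-- The standard Borel space of countable groups with underlying set `ℕ`. -/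
abbrev XGp := { m : ℕ × ℕ → ℕ // IsGroupOp m }

/-- Embeddability of countable groups: an injective map preserving the multiplication. -/
def GpEmbeds (m m' : XGp) : Prop :=
  ∃ g : ℕ → ℕ, Function.Injective g ∧ ∀ x y, g (m.1 (x, y)) = m'.1 (g x, g y)

/-- Isomorphism of countable groups: a bijective map preserving the multiplication. -/
def GpIso (m m' : XGp) : Prop :=
  ∃ g : ℕ → ℕ, Function.Bijective g ∧ ∀ x y, g (m.1 (x, y)) = m'.1 (g x, g y)

/-! ### The building block group -/

/-- The group algebra `𝔽₃[ℚ]`. -/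
abbrev GK := AddMonoidAlgebra (ZMod 3) ℚ

/-- The unit `± X^q`. -/
noncomputable def gX (e : ℤˣ) (q : ℚ) : GK := AddMonoidAlgebra.single q (((e : ℤ)) : ZMod 3)

theorem gX_mul (e e' : ℤˣ) (q q' : ℚ) : gX e q * gX e' q' = gX (e * e') (q + q') := by
  unfold gX
  rw [AddMonoidAlgebra.single_mul_single]
  push_cast
  rfl

theorem gX_one : gX 1 0 = 1 := by
  unfold gX
  simp [AddMonoidAlgebra.one_def]

theorem gX_eq_one {q : ℚ} (h : gX 1 q = 1) : q = 0 := by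
  unfold gX at h
  rw [AddMonoidAlgebra.one_def] at h
  have := (AddMonoidAlgebra.single_left_inj (R := ZMod 3) (r := 1) (m₁ := q) (m₂ := 0) (by decide)).1
  apply this
  simpa using h

/-- The affine group `𝔽₃[ℚ] ⋊ (± X^ℚ)`. -/
@[ext] structure GP where
  e : ℤˣ
  q : ℚ
  n : GK

namespace GP

noncomputable instance : Mul GP := ⟨fun a b => ⟨a.e * b.e, a.q + b.q, a.n + gX a.e a.q * b.n⟩⟩
noncomputable instance : One GP := ⟨⟨1, 0, 0⟩⟩
noncomputable instance : Inv GP := ⟨fun a => ⟨a.e⁻¹, -a.q, -(gX a.e⁻¹ (-a.q) * a.n)⟩⟩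

@[simp] theorem mul_e (a b : GP) : (a * b).e = a.e * b.e := rfl
@[simp] theorem mul_q (a b : GP) : (a * b).q = a.q + b.q := rfl
@[simp] theorem mul_n (a b : GP) : (a * b).n = a.n + gX a.e a.q * b.n := rfl
@[simp] theorem one_e : (1 : GP).e = 1 := rfl
@[simp] theorem one_q : (1 : GP).q = 0 := rfl
@[simp] theorem one_n : (1 : GP).n = 0 := rfl
@[simp] theorem inv_e (a : GP) : (a⁻¹).e = a.e⁻¹ := rfl
@[simp] theorem inv_q (a : GP) : (a⁻¹).q = -a.q := rfl
@[simp] theorem inv_n (a : GP) : (a⁻¹).n = -(gX a.e⁻¹ (-a.q) * a.n) := rfl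

noncomputable instance : Group GP :=
  Group.ofLeftAxioms
    (by
      intro a b c
      ext1
      · simp [mul_assoc]
      · simp [add_assoc]
      · simp only [mul_n, mul_e, mul_q, ← gX_mul]; ring)
    (by
      intro a
      ext1
      · simp
      · simp
      · simp [gX_one])
    (by
      intro a
      ext1
      · simp
      · simp
      · simp)

end GP

theorem gK_three (n : GK) : n + n + n = 0 := by
  have h : (3 : GK) = 0 := by
    have h0 : (3 : GK) = algebraMap (ZMod 3) GK 3 := (map_ofNat _ 3).symm
    rw [h0, show (3 : ZMod 3) = 0 from rfl, map_zero]
  have : n + n + n = 3 * n := by ring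
  rw [this, h, zero_mul]

theorem gP_pow_six (g : GP) (h : g.q = 0) : g ^ 6 = 1 := by
  have h2 : (g * g).e = 1 := by simp
  have h3 : (g * g).q = 0 := by simp [h]
  have : g ^ 6 = (g * g) * (g * g) * (g * g) := by
    simp only [pow_succ, pow_zero, one_mul, mul_assoc]
  rw [this]
  generalize g * g = k at *
  ext1
  · simp [h2]
  · simp [h3]
  · simp only [GP.mul_n, GP.mul_e, GP.mul_q, h2, h3, mul_one, add_zero, gX_one, one_mul]
    exact gK_three _

/-- translation element -/
noncomputable def gT (q : ℚ) : GP := ⟨1, q, 0⟩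
noncomputable def gTau : GP := ⟨1, 0, 1⟩
noncomputable def gIota : GP := ⟨-1, 0, 0⟩

theorem gT_add (q r : ℚ) : gT (q + r) = gT q * gT r := by
  ext1 <;> simp [gT]

theorem gT_zero : gT 0 = 1 := by
  ext1 <;> simp [gT]

theorem gIota_comm (g : GP) (h : g * gIota = gIota * g) : g.n = 0 := by
  have := congrArg GP.n h
  simp only [GP.mul_n, gIota] at this
  have h1 : gX (-1) 0 = -1 := by
    unfold gX
    rw [AddMonoidAlgebra.one_def]
    simp
  rw [h1] at this
  have h3 := gK_three g.n
  have h4 : g.n = - g.n := by simpa using this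
  have h5 : g.n + g.n = 0 := by
    nth_rewrite 2 [h4]; simp
  rw [h5] at h3
  simpa using h3

theorem gIota_comm_T (q : ℚ) : gT q * gIota = gIota * gT q := by
  ext1 <;> simp [gT, gIota]

theorem gPerp (q r : ℚ) :
    gT q * (gT r * gTau * (gT r)⁻¹ * gTau⁻¹) = (gT r * gTau * (gT r)⁻¹ * gTau⁻¹) * gT q ↔
      q = 0 ∨ r = 0 := by
  have key : gT r * gTau * (gT r)⁻¹ * gTau⁻¹ = ⟨1, 0, gX 1 r - 1⟩ := by
    ext1
    · simp [gT, gTau]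
    · simp [gT, gTau]
    · simp only [gT, gTau, GP.mul_n, GP.mul_e, GP.mul_q, GP.inv_n, GP.inv_e, GP.inv_q]
      simp [gX_one, sub_eq_add_neg]
  rw [key]
  constructor
  · intro h
    have := congrArg GP.n h
    simp only [gT, GP.mul_n, mul_zero, add_zero, zero_add] at this
    have h2 : (gX 1 q - 1) * (gX 1 r - 1) = 0 := by
      rw [sub_mul, this]; ring
    rcases mul_eq_zero.1 h2 with h | h
    · exact Or.inl (gX_eq_one (sub_eq_zero.1 h))
    · exact Or.inr (gX_eq_one (sub_eq_zero.1 h))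
  · rintro (rfl | rfl)
    · simp [gT_zero]
    · have : (⟨1, 0, gX 1 0 - 1⟩ : GP) = 1 := by
        ext1 <;> simp [gX_one]
      rw [this]; simp

/-! ### The torsion-free abelian groups attached to trees -/

/-- Combinatorial data: a forest with an order on its levels, and a supply of primes. -/
structure GFrame (V : Type) where
  le : V → V → Prop
  lev : V → ℕ
  par : V → V
  root : V
  z : V
  pr : V ⊕ ℕ → ℕ
  le_refl : ∀ v, le v v
  le_trans : ∀ u v w, le u v → le v w → le u w
  le_antisymm : ∀ v w, le v w → le w v → v = w
  le_lev : ∀ v w, le v w → lev v = lev w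
  lev_par : ∀ v n, lev v = n + 1 → lev (par v) = n
  lev_zero : ∀ v, lev v = 0 → v = root
  lev_root : lev root = 0
  pr_prime : ∀ x, (pr x).Prime
  pr_inj : Function.Injective pr
  pr_odd : ∀ x, pr x ≠ 2

theorem pn_add {p : ℕ} (hp : p.Prime) {a b : ℚ} (ha : padicNorm p a ≤ 1) (hb : padicNorm p b ≤ 1) :
    padicNorm p (a + b) ≤ 1 := by
  have := Fact.mk hp
  exact (padicNorm.nonarchimedean).trans (max_le ha hb)

theorem pn_mul {p : ℕ} (hp : p.Prime) {a b : ℚ} (ha : padicNorm p a ≤ 1) (hb : padicNorm p b ≤ 1) :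
    padicNorm p (a * b) ≤ 1 := by
  have := Fact.mk hp
  rw [padicNorm.mul]
  exact mul_le_one₀ ha (padicNorm.nonneg _) hb

theorem pn_inv_pow {p q : ℕ} (hp : p.Prime) (hq : q.Prime) (h : p ≠ q) (k : ℕ) :
    padicNorm p (((q : ℚ) ^ k)⁻¹) ≤ 1 := by
  have := Fact.mk hp
  have := Fact.mk hq
  have h1 : padicNorm p q = 1 := padicNorm.padicNorm_of_prime_of_ne h
  have h2 : padicNorm p ((q : ℚ) ^ k) = 1 := by
    induction k with
    | zero => simp
    | succ k ih => rw [pow_succ, padicNorm.mul, ih, h1, one_mul]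
  have h3 : padicNorm p (((q : ℚ) ^ k)⁻¹) * padicNorm p ((q : ℚ) ^ k) = 1 := by
    rw [← padicNorm.mul, inv_mul_cancel₀, padicNorm.one]
    have := hq.pos
    positivity
  rw [h2, mul_one] at h3
  exact h3.le

theorem pn_div {p : ℕ} (hp : p.Prime) {a : ℚ}
    (h : ∀ k : ℕ, ∃ b, padicNorm p b ≤ 1 ∧ a = (p : ℚ) ^ k * b) : a = 0 := by
  have := Fact.mk hp
  by_contra ha
  have hpos : 0 < padicNorm p a := lt_of_le_of_ne (padicNorm.nonneg _) (padicNorm.nonzero ha).symm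
  have hp1 : padicNorm p p < 1 := padicNorm.padicNorm_p_lt_one_of_prime
  obtain ⟨k, hk⟩ := exists_pow_lt_of_lt_one hpos hp1
  obtain ⟨b, hb, hab⟩ := h k
  have h2 : padicNorm p ((p : ℚ) ^ k) = padicNorm p p ^ k := by
    clear hk hab
    induction k with
    | zero => simp
    | succ k ih => rw [pow_succ, padicNorm.mul, ih, pow_succ]
  have : padicNorm p a ≤ padicNorm p p ^ k := by
    rw [hab, padicNorm.mul, h2]
    exact mul_le_of_le_one_right (pow_nonneg (padicNorm.nonneg _) _) hb
  exact absurd this (not_le.2 hk)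

namespace GFrame
variable {V : Type} (F : GFrame V)

open Classical in
noncomputable def kap (n : ℕ) (v : V) : V := if F.lev v = n + 1 then F.par v else v

/-- The group attached to a set of nodes. -/
noncomputable def A (T : Set V) : AddSubgroup (V →₀ ℚ) where
  carrier := {a | (∀ v, a v ≠ 0 → v ∈ T) ∧
    (∀ w v, ¬ F.le w v → padicNorm (F.pr (Sum.inl w)) (a v) ≤ 1) ∧
    ∀ n v, padicNorm (F.pr (Sum.inr n)) (Finsupp.mapDomain (F.kap n) a v) ≤ 1}
  zero_mem' := by
    refine ⟨?_, ?_, ?_⟩ <;> simp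
  add_mem' := by
    rintro a b ⟨ha1, ha2, ha3⟩ ⟨hb1, hb2, hb3⟩
    refine ⟨?_, ?_, ?_⟩
    · intro v hv
      by_cases h : a v = 0
      · apply hb1; intro h'; apply hv; simp [h, h']
      · exact ha1 v h
    · intro w v h
      exact pn_add (F.pr_prime _) (ha2 w v h) (hb2 w v h)
    · intro n v
      rw [Finsupp.mapDomain_add]
      exact pn_add (F.pr_prime _) (ha3 n v) (hb3 n v)
  neg_mem' := by
    rintro a ⟨ha1, ha2, ha3⟩
    have hn : ∀ (p : ℕ) (x : ℚ), padicNorm p (-x) = padicNorm p x := fun p x => padicNorm.neg x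
    refine ⟨?_, ?_, ?_⟩
    · intro v hv
      exact ha1 v (by simpa using hv)
    · intro w v h
      rw [Finsupp.neg_apply, hn]
      exact ha2 w v h
    · intro n v
      have : Finsupp.mapDomain (F.kap n) (-a) = - Finsupp.mapDomain (F.kap n) a :=
        map_neg (Finsupp.mapDomain.addMonoidHom (F.kap n)) a
      rw [this, Finsupp.neg_apply, hn]
      exact ha3 n v

variable {F} {T T' : Set V}

theorem mem_A {a : V →₀ ℚ} : a ∈ F.A T ↔ (∀ v, a v ≠ 0 → v ∈ T) ∧
    (∀ w v, ¬ F.le w v → padicNorm (F.pr (Sum.inl w)) (a v) ≤ 1) ∧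
    ∀ n v, padicNorm (F.pr (Sum.inr n)) (Finsupp.mapDomain (F.kap n) a v) ≤ 1 := Iff.rfl

theorem smul_mem {a : V →₀ ℚ} (ha : a ∈ F.A T) {c : ℚ} (hc : ∀ x, padicNorm (F.pr x) c ≤ 1) :
    c • a ∈ F.A T := by
  obtain ⟨h1, h2, h3⟩ := ha
  refine ⟨?_, ?_, ?_⟩
  · intro v hv
    apply h1; intro h; apply hv; simp [h]
  · intro w v h
    exact pn_mul (F.pr_prime _) (hc _) (h2 w v h)
  · intro n v
    rw [Finsupp.mapDomain_smul]
    exact pn_mul (F.pr_prime _) (hc _) (h3 n v)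

theorem half_mem {a : V →₀ ℚ} (ha : a ∈ F.A T) : (2 : ℚ)⁻¹ • a ∈ F.A T := by
  apply smul_mem ha
  intro x
  have := pn_inv_pow (F.pr_prime x) Nat.prime_two (F.pr_odd x) 1
  simpa using this

theorem pn_single {p : ℕ} {c : ℚ} (hc : padicNorm p c ≤ 1) (v w : V) :
    padicNorm p (Finsupp.single v c w) ≤ 1 := by
  classical
  rw [Finsupp.single_apply]
  split_ifs
  · exact hc
  · simp

theorem b_div_mem {v : V} (hv : v ∈ T) (k : ℕ) :
    Finsupp.single v (((F.pr (Sum.inl v) : ℚ) ^ k)⁻¹) ∈ F.A T := by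
  classical
  refine ⟨?_, ?_, ?_⟩
  · intro w hw
    by_cases h : v = w
    · exact h ▸ hv
    · exact absurd (Finsupp.single_eq_of_ne (Ne.symm h)) hw
  · intro w u h
    rw [Finsupp.single_apply]
    split_ifs with h'
    · apply pn_inv_pow (F.pr_prime _) (F.pr_prime _)
      intro h2
      have := F.pr_inj h2
      simp only [Sum.inl.injEq] at this
      subst this h'
      exact h (F.le_refl _)
    · simp
  · intro n u
    rw [Finsupp.mapDomain_single]
    apply pn_single
    apply pn_inv_pow (F.pr_prime _) (F.pr_prime _)
    intro h2
    have := F.pr_inj h2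
    simp at this

theorem b_mem {v : V} (hv : v ∈ T) : Finsupp.single v (1 : ℚ) ∈ F.A T := by
  simpa using b_div_mem (F := F) hv 0

theorem d_div_mem {v : V} (hv : v ∈ T) (hp : F.par v ∈ T) {n : ℕ} (hn : F.lev v = n + 1) (k : ℕ) :
    Finsupp.single v (((F.pr (Sum.inr n) : ℚ) ^ k)⁻¹) -
      Finsupp.single (F.par v) (((F.pr (Sum.inr n) : ℚ) ^ k)⁻¹) ∈ F.A T := by
  classical
  have hneg : ∀ (p : ℕ) (x : ℚ), padicNorm p (-x) = padicNorm p x := fun p x => padicNorm.neg x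
  refine ⟨?_, ?_, ?_⟩
  · intro w hw
    by_cases h : v = w
    · exact h ▸ hv
    · by_cases h' : F.par v = w
      · exact h' ▸ hp
      · exfalso; apply hw
        rw [Finsupp.sub_apply, Finsupp.single_eq_of_ne (Ne.symm h),
          Finsupp.single_eq_of_ne (Ne.symm h'), sub_zero]
  · intro w u h
    have h1 : padicNorm (F.pr (Sum.inl w)) (((F.pr (Sum.inr n) : ℚ) ^ k)⁻¹) ≤ 1 := by
      apply pn_inv_pow (F.pr_prime _) (F.pr_prime _)
      intro h2
      have := F.pr_inj h2
      simp at this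
    rw [Finsupp.sub_apply, sub_eq_add_neg]
    apply pn_add (F.pr_prime _) (pn_single h1 _ _)
    rw [hneg]
    exact pn_single h1 _ _
  · intro m u
    have hs : Finsupp.mapDomain (F.kap m) (Finsupp.single v (((F.pr (Sum.inr n) : ℚ) ^ k)⁻¹) -
      Finsupp.single (F.par v) (((F.pr (Sum.inr n) : ℚ) ^ k)⁻¹)) =
       Finsupp.single (F.kap m v) (((F.pr (Sum.inr n) : ℚ) ^ k)⁻¹) -
      Finsupp.single (F.kap m (F.par v)) (((F.pr (Sum.inr n) : ℚ) ^ k)⁻¹) := by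
      have := map_sub (Finsupp.mapDomain.addMonoidHom (M := ℚ) (F.kap m))
        (Finsupp.single v (((F.pr (Sum.inr n) : ℚ) ^ k)⁻¹))
        (Finsupp.single (F.par v) (((F.pr (Sum.inr n) : ℚ) ^ k)⁻¹))
      simpa [Finsupp.mapDomain.addMonoidHom, Finsupp.mapDomain_single] using this
    rw [hs]
    by_cases hm : m = n
    · subst hm
      have h1 : F.kap m v = F.par v := by simp [kap, hn]
      have h2 : F.kap m (F.par v) = F.par v := by
        have := F.lev_par v m hn
        simp [kap, this]
      rw [h1, h2]; simp
    · have h1 : padicNorm (F.pr (Sum.inr m)) (((F.pr (Sum.inr n) : ℚ) ^ k)⁻¹) ≤ 1 := by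
        apply pn_inv_pow (F.pr_prime _) (F.pr_prime _)
        intro h2
        have := F.pr_inj h2
        simp only [Sum.inr.injEq] at this
        exact hm this
      rw [Finsupp.sub_apply, sub_eq_add_neg]
      apply pn_add (F.pr_prime _) (pn_single h1 _ _)
      rw [hneg]
      exact pn_single h1 _ _

/-- the basis element -/
noncomputable def b (F : GFrame V) {T : Set V} (v : V) (hv : v ∈ T) : F.A T :=
  ⟨Finsupp.single v 1, b_mem hv⟩

theorem hom_supp (ψ : F.A T →+ F.A T') {v : V} (hv : v ∈ T) {w : V}
    (h : (ψ (F.b v hv)).1 w ≠ 0) : F.le v w := by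
  by_contra hvw
  apply h
  apply pn_div (F.pr_prime (Sum.inl v))
  intro k
  refine ⟨(ψ ⟨_, b_div_mem hv k⟩).1 w, (ψ ⟨_, b_div_mem hv k⟩).2.2.1 v w hvw, ?_⟩
  have h1 : F.b v hv = (F.pr (Sum.inl v) ^ k) • (⟨_, b_div_mem hv k⟩ : F.A T) := by
    apply Subtype.ext
    have h0 := (F.pr_prime (Sum.inl v)).ne_zero
    simp [b, h0]
  rw [h1, map_nsmul]
  simp

theorem hom_par (ψ : F.A T →+ F.A T') {v : V} (hv : v ∈ T) (hp : F.par v ∈ T) {n : ℕ}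
    (hn : F.lev v = n + 1) :
    (ψ (F.b _ hp)).1 = Finsupp.mapDomain F.par (ψ (F.b v hv)).1 := by
  have key : Finsupp.mapDomain (F.kap n) (ψ (F.b v hv - F.b _ hp)).1 = 0 := by
    ext w
    apply pn_div (F.pr_prime (Sum.inr n))
    intro k
    refine ⟨Finsupp.mapDomain (F.kap n) (ψ ⟨_, d_div_mem hv hp hn k⟩).1 w,
      (ψ ⟨_, d_div_mem hv hp hn k⟩).2.2.2 n w, ?_⟩
    have h1 : F.b v hv - F.b _ hp = (F.pr (Sum.inr n) ^ k) •
        (⟨_, d_div_mem hv hp hn k⟩ : F.A T) := by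
      apply Subtype.ext
      have h0 := (F.pr_prime (Sum.inr n)).ne_zero
      simp [b, h0, smul_sub]
    rw [h1, map_nsmul]
    have h2 : ((F.pr (Sum.inr n) ^ k • ψ ⟨_, d_div_mem hv hp hn k⟩ : F.A T') : V →₀ ℚ) =
      ((F.pr (Sum.inr n) : ℚ) ^ k) • (ψ ⟨_, d_div_mem hv hp hn k⟩ : V →₀ ℚ) := by
      ext; simp
    rw [h2, Finsupp.mapDomain_smul]
    simp
  rw [map_sub] at key
  have key2 : Finsupp.mapDomain (F.kap n) (ψ (F.b v hv)).1 =
      Finsupp.mapDomain (F.kap n) (ψ (F.b _ hp)).1 := by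
    have := map_sub (Finsupp.mapDomain.addMonoidHom (M := ℚ) (F.kap n)) (ψ (F.b v hv)).1
      (ψ (F.b _ hp)).1
    apply sub_eq_zero.1
    exact this.symm.trans key
  have e1 : Finsupp.mapDomain (F.kap n) (ψ (F.b v hv)).1 =
      Finsupp.mapDomain F.par (ψ (F.b v hv)).1 := by
    apply Finsupp.mapDomain_congr
    intro w hw
    have := F.le_lev _ _ (hom_supp ψ hv (Finsupp.mem_support_iff.1 hw))
    rw [hn] at this
    simp [kap, this.symm]
  have e2 : Finsupp.mapDomain (F.kap n) (ψ (F.b _ hp)).1 = (ψ (F.b _ hp)).1 := by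
    conv_rhs => rw [← Finsupp.mapDomain_id (v := (ψ (F.b _ hp)).1)]
    apply Finsupp.mapDomain_congr
    intro w hw
    have := F.le_lev _ _ (hom_supp ψ hp (Finsupp.mem_support_iff.1 hw))
    rw [F.lev_par v n hn] at this
    simp [kap, ← this]
  rw [← e2, ← key2, e1]

/-- Two maps agreeing on the basis agree. -/
theorem hom_rigid (ψ : F.A T →+ F.A T') (h : ∀ v hv, (ψ (F.b v hv)).1 = Finsupp.single v 1)
    (a : F.A T) : (ψ a).1 = a.1 := by
  classical
  let D : F.A T →+ (V →₀ ℚ) := (F.A T').subtype.comp ψ - (F.A T).subtype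
  have hD : ∀ a, D a = (ψ a).1 - a.1 := fun a => rfl
  let S : AddSubgroup (V →₀ ℚ) := D.ker.map (F.A T).subtype
  have hbS : ∀ v, v ∈ T → Finsupp.single v (1 : ℚ) ∈ S := by
    intro v hv
    refine ⟨F.b v hv, ?_, rfl⟩
    change D _ = 0
    rw [hD, h, sub_eq_zero]; rfl
  have main : ∀ f : V →₀ ℚ, (∀ v, f v ≠ 0 → v ∈ T) → ∃ N : ℕ, N ≠ 0 ∧ N • f ∈ S := by
    intro f
    induction f using Finsupp.induction with
    | zero => intro _; exact ⟨1, one_ne_zero, by simp⟩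
    | single_add v c f hvf hc ih =>
      intro hT
      have hv : v ∈ T := by
        apply hT
        rw [Finsupp.notMem_support_iff] at hvf
        simp [hvf, hc]
      obtain ⟨N, hN, hNS⟩ := ih (by
        intro w hw
        apply hT
        have : v ≠ w := by
          rintro rfl
          exact hvf (Finsupp.mem_support_iff.2 hw)
        simpa [Finsupp.single_eq_of_ne this.symm] using hw)
      refine ⟨N * c.den, mul_ne_zero hN c.den_nz, ?_⟩
      have h1 : c.den • Finsupp.single v c ∈ S := by
        have : c.den • Finsupp.single v c = c.num • Finsupp.single v (1 : ℚ) := by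
          simp [Rat.den_mul_eq_num]
        rw [this]
        exact S.zsmul_mem (hbS v hv) _
      rw [smul_add]
      apply S.add_mem
      · rw [mul_smul]; exact S.nsmul_mem h1 _
      · rw [mul_comm, mul_smul]; exact S.nsmul_mem hNS _
  obtain ⟨N, hN, hNS⟩ := main a.1 a.2.1
  obtain ⟨a', ha', haa⟩ := hNS
  have : a' = N • a := Subtype.ext haa
  subst this
  have h0 : D (N • a) = 0 := ha'
  rw [map_nsmul, hD] at h0
  exact sub_eq_zero.1 ((smul_eq_zero.1 h0).resolve_left hN)

end GFrame

/-! ### The groups attached to trees -/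

namespace GFrame
variable {V : Type} {F : GFrame V} {T T' : Set V}

noncomputable def incl (a : V →₀ ℚ) : V → GP := fun v => gT (a v)
noncomputable def tau : V → GP := fun _ => gTau
noncomputable def iota : V → GP := fun _ => gIota

theorem incl_add (a b : V →₀ ℚ) : incl (a + b) = incl a * incl b := by
  funext v; simp [incl, gT_add]

theorem incl_zero : incl (0 : V →₀ ℚ) = 1 := by
  funext v; simp [incl, gT_zero]

variable (F T) in
/-- The group attached to a set of nodes. -/
noncomputable def G : Subgroup (V → GP) :=
  Subgroup.closure (incl '' (F.A T : Set (V →₀ ℚ)) ∪ {tau, iota})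

theorem incl_mem {a : V →₀ ℚ} (ha : a ∈ F.A T) : incl a ∈ F.G T :=
  Subgroup.subset_closure (Or.inl ⟨a, ha, rfl⟩)

theorem tau_mem : tau ∈ F.G T := Subgroup.subset_closure (Or.inr (Or.inl rfl))
theorem iota_mem : iota ∈ F.G T := Subgroup.subset_closure (Or.inr (Or.inr rfl))

theorem G_induction {p : ∀ g, g ∈ F.G T → Prop}
    (h1 : ∀ a (ha : a ∈ F.A T), p (incl a) (incl_mem ha)) (h2 : p tau tau_mem)
    (h3 : p iota iota_mem) (h4 : p 1 (one_mem _))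
    (h5 : ∀ x y hx hy, p x hx → p y hy → p (x * y) (mul_mem hx hy))
    (h6 : ∀ x hx, p x hx → p x⁻¹ (inv_mem hx)) (g : V → GP) (hg : g ∈ F.G T) : p g hg := by
  unfold G at hg
  induction hg using Subgroup.closure_induction with
  | mem x hx =>
    rcases hx with ⟨a, ha, rfl⟩ | rfl | rfl
    · exact h1 a ha
    · exact h2
    · exact h3
  | one => exact h4
  | mul x y hx hy px py => exact h5 x y hx hy px py
  | inv x hx px => exact h6 x hx px

theorem exists_q {g : V → GP} (hg : g ∈ F.G T) : ∃ a : F.A T, ∀ v, a.1 v = (g v).q := by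
  induction g, hg using G_induction with
  | h1 a ha => exact ⟨⟨a, ha⟩, fun v => rfl⟩
  | h2 => exact ⟨0, fun v => rfl⟩
  | h3 => exact ⟨0, fun v => rfl⟩
  | h4 => exact ⟨0, fun v => rfl⟩
  | h5 x y hx hy px py =>
    obtain ⟨a, ha⟩ := px
    obtain ⟨b, hb⟩ := py
    exact ⟨a + b, fun v => by simp [ha, hb]⟩
  | h6 x hx px =>
    obtain ⟨a, ha⟩ := px
    exact ⟨-a, fun v => by simp [ha]⟩

noncomputable def qA (g : F.G T) : F.A T := (exists_q g.2).choose

theorem qA_apply (g : F.G T) (v : V) : (qA g).1 v = (g.1 v).q := (exists_q g.2).choose_spec v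

theorem const_off {g : V → GP} (hg : g ∈ F.G T) {w w' : V} (hw : w ∉ T) (hw' : w' ∉ T) :
    g w = g w' := by
  induction g, hg using G_induction with
  | h1 a ha =>
    have h1 : a w = 0 := by by_contra h; exact hw (ha.1 _ h)
    have h2 : a w' = 0 := by by_contra h; exact hw' (ha.1 _ h)
    simp [incl, h1, h2]
  | h2 => rfl
  | h3 => rfl
  | h4 => rfl
  | h5 x y hx hy px py => simp [px, py]
  | h6 x hx px => simp [px]

noncomputable def inclG (a : F.A T) : F.G T := ⟨incl a.1, incl_mem a.2⟩

theorem inclG_add (a b : F.A T) : inclG (a + b) = inclG a * inclG b :=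
  Subtype.ext (incl_add _ _)

/-- the induced homomorphism on the abelian parts -/
noncomputable def psi (φ : F.G T →* F.G T') : F.A T →+ F.A T' :=
  AddMonoidHom.mk' (fun a => qA (φ (inclG a))) (by
    intro a b
    apply Subtype.ext
    ext v
    rw [inclG_add, map_mul]
    simp [qA_apply])

theorem psi_apply (φ : F.G T →* F.G T') (a : F.A T) (v : V) :
    (psi φ a).1 v = ((φ (inclG a)).1 v).q := qA_apply _ _

theorem psi_inj (φ : F.G T →* F.G T') (hφ : Function.Injective φ) {a : F.A T} (h : psi φ a = 0) :
    a = 0 := by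
  have h1 : φ (inclG a) ^ 6 = 1 := by
    apply Subtype.ext
    funext v
    apply gP_pow_six
    rw [← psi_apply, h]
    rfl
  rw [← map_pow] at h1
  have h2 : inclG a ^ 6 = 1 := hφ (by rw [h1, map_one])
  apply Subtype.ext
  ext v
  have h3 := congrArg (fun g : F.G T => (g.1 v).q) h2
  simp only [pow_succ, pow_zero, one_mul] at h3
  have h4 : a.1 v + a.1 v + a.1 v + a.1 v + a.1 v + a.1 v = 0 := h3
  have : a.1 v = 0 := by linarith
  exact this

theorem exists_branch (φ : F.G T →* F.G T') (hφ : Function.Injective φ) (v : ℕ → V)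
    (hpar : ∀ n, F.par (v (n + 1)) = v n) (hlev : ∀ n, F.lev (v n) = n) (hT : ∀ n, v n ∈ T) :
    ∃ w : ℕ → V, (∀ n, w n ∈ T') ∧ (∀ n, F.le (v n) (w n)) ∧ ∀ n, F.par (w (n + 1)) = w n := by
  classical
  let s : ℕ → V →₀ ℚ := fun n => (psi φ (F.b (v n) (hT n))).1
  have hs : ∀ n, s n = Finsupp.mapDomain F.par (s (n + 1)) := by
    intro n
    have hp : F.par (v (n + 1)) ∈ T := by rw [hpar]; exact hT n
    have := hom_par (psi φ) (hT (n + 1)) hp (hlev (n + 1))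
    change _ = (psi φ (F.b (v (n + 1)) (hT (n + 1)))).1.mapDomain F.par
    rw [← this]
    simp only [hpar]
    rfl
  have h0 : s 0 ≠ 0 := by
    intro h
    have := psi_inj φ hφ (Subtype.ext h)
    have h2 := congrArg (fun a : F.A T => a.1 (v 0)) this
    simp [b] at h2
  have step : ∀ n (w : {w // w ∈ (s n).support}),
      ∃ w' : {w // w ∈ (s (n + 1)).support}, F.par w'.1 = w.1 := by
    rintro n ⟨w, hw⟩
    rw [hs n] at hw
    have := Finsupp.mapDomain_support hw
    obtain ⟨w', hw', e⟩ := Finset.mem_image.1 this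
    exact ⟨⟨w', hw'⟩, e⟩
  choose f hf using step
  obtain ⟨w0, hw0⟩ := Finsupp.support_nonempty_iff.2 h0
  let seq : ∀ n, {w // w ∈ (s n).support} := fun n => Nat.rec ⟨w0, hw0⟩ (fun n w => f n w) n
  refine ⟨fun n => (seq n).1, fun n => ?_, fun n => ?_, fun n => hf n (seq n)⟩
  · exact (psi φ (F.b (v n) (hT n))).2.1 _ (Finsupp.mem_support_iff.1 (seq n).2)
  · exact hom_supp (psi φ) (hT n) (Finsupp.mem_support_iff.1 (seq n).2)

theorem embeds (i : V → V) (hi : Function.Injective i) (hlev : ∀ v, F.lev (i v) = F.lev v)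
    (hpar : ∀ v, F.par (i v) = i (F.par v)) (hle : ∀ v, F.le v (i v))
    (hT : ∀ v ∈ T, i v ∈ T') (hz : F.z ∉ T) (hz' : F.z ∉ T') :
    ∃ φ : F.G T →* F.G T', Function.Injective φ := by
  classical
  let k : V → V := fun w => if h : ∃ v ∈ T, i v = w then h.choose else F.z
  have hk : ∀ v ∈ T, k (i v) = v := by
    intro v hv
    have h : ∃ v' ∈ T, i v' = i v := ⟨v, hv, rfl⟩
    simp only [k, dif_pos h]
    exact hi h.choose_spec.2
  have hk' : ∀ w, (∀ v ∈ T, i v ≠ w) → k w = F.z := by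
    intro w hw
    have h : ¬ ∃ v ∈ T, i v = w := by
      rintro ⟨v, hv, e⟩; exact hw v hv e
    simp only [k, dif_neg h]
  let K : (V → GP) →* (V → GP) :=
    { toFun := fun g => g ∘ k, map_one' := rfl, map_mul' := fun _ _ => rfl }
  have hmd : ∀ a ∈ F.A T, incl a ∘ k = incl (Finsupp.mapDomain i a) := by
    intro a ha
    have hz0 : ∀ v, v ∉ T → a v = 0 := by
      intro v hv; by_contra h; exact hv (ha.1 _ h)
    funext w
    simp only [incl, Function.comp]
    congr 1
    by_cases h : ∃ v ∈ T, i v = w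
    · obtain ⟨v, hv, rfl⟩ := h
      rw [hk v hv, Finsupp.mapDomain_apply hi]
    · push Not at h
      rw [hk' w h, hz0 _ hz]
      by_cases h2 : w ∈ Set.range i
      · obtain ⟨v, rfl⟩ := h2
        rw [Finsupp.mapDomain_apply hi, hz0]
        intro hv
        exact h v hv rfl
      · rw [Finsupp.mapDomain_of_notMem_range _ _ h2]
  have hA : ∀ a ∈ F.A T, Finsupp.mapDomain i a ∈ F.A T' := by
    intro a ha
    refine ⟨?_, ?_, ?_⟩
    · intro w hw
      by_cases h2 : w ∈ Set.range i
      · obtain ⟨v, rfl⟩ := h2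
        rw [Finsupp.mapDomain_apply hi] at hw
        exact hT v (ha.1 v hw)
      · exact absurd (Finsupp.mapDomain_of_notMem_range _ _ h2) hw
    · intro w u hwu
      by_cases h2 : u ∈ Set.range i
      · obtain ⟨v, rfl⟩ := h2
        rw [Finsupp.mapDomain_apply hi]
        apply ha.2.1
        intro h
        exact hwu (F.le_trans _ _ _ h (hle v))
      · rw [Finsupp.mapDomain_of_notMem_range _ _ h2]; simp
    · intro n u
      have hc : F.kap n ∘ i = i ∘ F.kap n := by
        funext v
        simp only [Function.comp, kap, hlev, hpar]
        split_ifs <;> rfl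
      rw [← Finsupp.mapDomain_comp, hc, Finsupp.mapDomain_comp]
      by_cases h2 : u ∈ Set.range i
      · obtain ⟨v, rfl⟩ := h2
        rw [Finsupp.mapDomain_apply hi]
        exact ha.2.2 n v
      · rw [Finsupp.mapDomain_of_notMem_range _ _ h2]; simp
  have hG : ∀ g ∈ F.G T, K g ∈ F.G T' := by
    intro g hg
    induction g, hg using G_induction with
    | h1 a ha =>
      change incl a ∘ k ∈ _
      rw [hmd a ha]; exact incl_mem (hA a ha)
    | h2 => exact tau_mem
    | h3 => exact iota_mem
    | h4 => exact one_mem _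
    | h5 x y hx hy px py => rw [map_mul]; exact mul_mem px py
    | h6 x hx px => rw [map_inv]; exact inv_mem px
  refine ⟨(K.comp (F.G T).subtype).codRestrict (F.G T') (fun g => hG g.1 g.2), ?_⟩
  intro g g' h
  have h1 : ∀ w, g.1 (k w) = g'.1 (k w) := fun w => congrFun (congrArg Subtype.val h) w
  have hgz : g.1 F.z = g'.1 F.z := by
    have := h1 F.z
    rwa [hk' F.z (fun v hv e => hz' (e ▸ hT v hv))] at this
  apply Subtype.ext
  funext v
  by_cases hv : v ∈ T
  · have := h1 (i v)
    rwa [hk v hv] at this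
  · rw [const_off g.2 hv hz, const_off g'.2 hv hz, hgz]

variable (F T) in
noncomputable def tauG : F.G T := ⟨tau, tau_mem⟩
variable (F T) in
noncomputable def iotaG : F.G T := ⟨iota, iota_mem⟩

theorem hom_incl (φ : F.G T →* F.G T') (hι : φ (iotaG F T) = iotaG F T') (a : F.A T) :
    φ (inclG a) = inclG (psi φ a) := by
  have h1 : inclG a * iotaG F T = iotaG F T * inclG a := by
    apply Subtype.ext; funext v; exact gIota_comm_T _
  have h2 : φ (inclG a) * iotaG F T' = iotaG F T' * φ (inclG a) := by
    rw [← hι, ← map_mul, h1, map_mul]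
  let a' : F.A T := ⟨_, half_mem a.2⟩
  have h3 : a = a' + a' := by
    apply Subtype.ext
    ext v
    simp [a']
    ring
  have h4 : ∀ v, ((φ (inclG a)).1 v).e = 1 := by
    intro v
    rw [h3, inclG_add, map_mul]
    simp
  apply Subtype.ext
  funext v
  apply GP.ext
  · exact h4 v
  · exact (psi_apply φ a v).symm
  · exact gIota_comm _ (congrFun (congrArg Subtype.val h2) v)

theorem perp_iff (a a' : F.A T) :
    inclG a * (inclG a' * tauG F T * (inclG a')⁻¹ * (tauG F T)⁻¹) =
      (inclG a' * tauG F T * (inclG a')⁻¹ * (tauG F T)⁻¹) * inclG a ↔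
    ∀ v, a.1 v = 0 ∨ a'.1 v = 0 := by
  rw [Subtype.ext_iff, funext_iff]
  exact forall_congr' fun v => gPerp _ _

theorem hom_perp (φ : F.G T →* F.G T') (hι : φ (iotaG F T) = iotaG F T')
    (hτ : φ (tauG F T) = tauG F T') {a a' : F.A T} (h : ∀ v, a.1 v = 0 ∨ a'.1 v = 0) (v : V) :
    (psi φ a).1 v = 0 ∨ (psi φ a').1 v = 0 := by
  rw [← perp_iff] at h
  have := congrArg φ h
  simp only [map_mul, map_inv, hτ, hom_incl φ hι] at this
  exact (perp_iff _ _).1 this v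

theorem iso_aux (σ : F.G T ≃* F.G T') (hι : σ (iotaG F T) = iotaG F T')
    (hτ : σ (tauG F T) = tauG F T') (hr : F.root ∈ T) (hr' : F.root ∈ T')
    (hσ : σ (inclG (F.b _ hr)) = inclG (F.b _ hr')) (hcl : ∀ v ∈ T, F.par v ∈ T) :
    T ⊆ T' ∧ ∀ g, (σ g).1 = g.1 := by
  classical
  have hι' : σ.symm (iotaG F T') = iotaG F T := by rw [← hι]; simp
  have hτ' : σ.symm (tauG F T') = tauG F T := by rw [← hτ]; simp
  let ψ := psi (σ : F.G T →* F.G T')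
  let ψ' := psi (σ.symm : F.G T' →* F.G T)
  have hψψ' : ∀ a, ψ (ψ' a) = a := by
    intro a
    have h1 : σ.symm (inclG a) = inclG (ψ' a) := hom_incl (σ.symm : F.G T' →* F.G T) hι' a
    have h2 : σ (inclG (ψ' a)) = inclG (ψ (ψ' a)) := hom_incl (σ : F.G T →* F.G T') hι _
    rw [← h1] at h2
    simp only [MulEquiv.apply_symm_apply] at h2
    apply Subtype.ext
    ext v
    have := congrArg (fun g : F.G T' => (g.1 v).q) h2
    exact this.symm
  have hsupp : ∀ v (hv : v ∈ T) w, (ψ (F.b v hv)).1 w ≠ 0 → w = v := by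
    intro v hv w hw
    have hwT : w ∈ T' := (ψ (F.b v hv)).2.1 w hw
    have hle := hom_supp ψ hv hw
    apply F.le_antisymm _ _ _ hle
    apply hom_supp ψ' hwT
    intro h0
    have hp : ∀ u, (F.b v hv).1 u = 0 ∨ (ψ' (F.b w hwT)).1 u = 0 := by
      intro u
      by_cases h : u = v
      · right; rw [h, h0]
      · left; exact Finsupp.single_eq_of_ne h
    have := hom_perp (σ : F.G T →* F.G T') hι hτ hp w
    rcases this with h | h
    · exact hw h
    · have h' : (ψ (ψ' (F.b w hwT))).1 w = 0 := h
      rw [hψψ'] at h'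
      simp [b] at h'
  have hsingle : ∀ v (hv : v ∈ T), ∃ c, (ψ (F.b v hv)).1 = Finsupp.single v c := by
    intro v hv
    refine ⟨(ψ (F.b v hv)).1 v, ?_⟩
    ext w
    by_cases h : w = v
    · subst h; simp
    · rw [Finsupp.single_eq_of_ne h]
      by_contra h2
      exact h (hsupp v hv w h2)
  have hone : ∀ n v (hv : v ∈ T), F.lev v = n → (ψ (F.b v hv)).1 = Finsupp.single v 1 := by
    intro n
    induction n with
    | zero =>
      intro v hv h
      have := F.lev_zero v h
      subst this
      ext u
      have h1 := psi_apply (σ : F.G T →* F.G T') (F.b _ hv) u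
      have h2 : (σ : F.G T →* F.G T') (inclG (F.b _ hv)) = inclG (F.b _ hr') := hσ
      rw [h2] at h1
      exact h1
    | succ n ih =>
      intro v hv h
      have h1 := hom_par ψ hv (hcl v hv) h
      rw [ih _ (hcl v hv) (F.lev_par v n h)] at h1
      obtain ⟨c, hc⟩ := hsingle v hv
      rw [hc, Finsupp.mapDomain_single] at h1
      have := congrArg (fun f : V →₀ ℚ => f (F.par v)) h1
      simp only [Finsupp.single_eq_same] at this
      rw [hc, this]
  have hrig := hom_rigid ψ (fun v hv => hone _ v hv rfl)
  refine ⟨?_, ?_⟩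
  · intro v hv
    apply (ψ (F.b v hv)).2.1
    rw [hrig]
    simp [b]
  · rintro ⟨g, hg⟩
    induction g, hg using G_induction with
    | h1 a ha =>
      have h2 : σ (inclG ⟨a, ha⟩) = inclG (ψ ⟨a, ha⟩) := hom_incl (σ : F.G T →* F.G T') hι _
      change (σ (inclG ⟨a, ha⟩)).1 = _
      rw [h2]
      change incl (ψ ⟨a, ha⟩).1 = _
      rw [hrig]
    | h2 => exact congrArg Subtype.val hτ
    | h3 => exact congrArg Subtype.val hι
    | h4 => exact congrArg Subtype.val (map_one σ)
    | h5 x y hx hy px py =>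
      have : (⟨x * y, mul_mem hx hy⟩ : F.G T) = ⟨x, hx⟩ * ⟨y, hy⟩ := rfl
      rw [this, map_mul, Subgroup.coe_mul, px, py]; rfl
    | h6 x hx px =>
      have : (⟨x⁻¹, inv_mem hx⟩ : F.G T) = (⟨x, hx⟩)⁻¹ := rfl
      rw [this, map_inv, Subgroup.coe_inv, px]; rfl

theorem A_mono (h : T ⊆ T') : F.A T ≤ F.A T' := fun _ ha => ⟨fun v hv => h (ha.1 v hv), ha.2⟩

theorem G_mono (h : T ⊆ T') : F.G T ≤ F.G T' := by
  apply Subgroup.closure_mono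
  apply Set.union_subset_union_left
  apply Set.image_mono
  exact A_mono h

theorem mem_G_iff (g : V → GP) : g ∈ F.G T ↔ ∃ s : Finset V, (s : Set V) ⊆ T ∧ g ∈ F.G (s : Set V) := by
  classical
  constructor
  · intro hg
    induction g, hg using G_induction with
    | h1 a ha =>
      refine ⟨a.support, fun v hv => ha.1 v (Finsupp.mem_support_iff.1 hv), incl_mem ⟨?_, ha.2⟩⟩
      intro v hv
      exact Finsupp.mem_support_iff.2 hv
    | h2 => exact ⟨∅, by simp, tau_mem⟩
    | h3 => exact ⟨∅, by simp, iota_mem⟩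
    | h4 => exact ⟨∅, by simp, one_mem _⟩
    | h5 x y hx hy px py =>
      obtain ⟨s, hs, hsx⟩ := px
      obtain ⟨t, ht, hty⟩ := py
      refine ⟨s ∪ t, by simp [hs, ht], mul_mem (G_mono ?_ hsx) (G_mono ?_ hty)⟩ <;> simp
    | h6 x hx px =>
      obtain ⟨s, hs, hsx⟩ := px
      exact ⟨s, hs, inv_mem hsx⟩
  · rintro ⟨s, hs, h⟩
    exact G_mono hs h

theorem closure_countable {G : Type*} [Group G] {s : Set G} (hs : s.Countable) :
    Countable (Subgroup.closure s) := by
  have : Countable s := hs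
  have h2 : Countable (FreeGroup s) := by
    unfold FreeGroup
    infer_instance
  rw [FreeGroup.closure_eq_range]
  exact (MonoidHom.rangeRestrict_surjective (FreeGroup.lift (Subtype.val : s → G))).countable

theorem G_countable [Countable V] : Countable (F.G T) := by
  apply closure_countable
  apply Set.Countable.union
  · exact (Set.to_countable _).image _
  · simp

theorem G_infinite {v : V} (hv : v ∈ T) : Infinite (F.G T) := by
  apply Infinite.of_injective (fun n : ℕ => inclG (n • F.b v hv))
  intro m n h
  have h2 := congrArg (fun g : F.G T => (g.1 v).q) h
  have h3 : (m • F.b v hv).1 v = (n • F.b v hv).1 v := h2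
  simpa [b] using h3

end GFrame

/-! ### The Borel part -/

/-- `(x, h, m, a)` such that `h` enumerates `G x` injectively, `m` is the multiplication
transported by `h`, and `a` are the indices of the distinguished elements. -/
def GW {X 𝒢 : Type*} [Group 𝒢] (G : X → Subgroup 𝒢) (c : Fin 3 → 𝒢) :
    Set (X × (ℕ → 𝒢) × (ℕ × ℕ → ℕ) × (Fin 3 → ℕ)) :=
  {w | (∀ i j, w.2.1 i = w.2.1 j → i = j) ∧ (∀ g, g ∈ G w.1 ↔ ∃ n, w.2.1 n = g) ∧
    (∀ i j, w.2.1 (w.2.2.1 (i, j)) = w.2.1 i * w.2.1 j) ∧ ∀ k, w.2.1 (w.2.2.2 k) = c k}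

section
variable {X 𝒢 : Type*} [Group 𝒢] {G : X → Subgroup 𝒢} {c : Fin 3 → 𝒢}

theorem GW_equiv {x : X} {h : ℕ → 𝒢} {m : ℕ × ℕ → ℕ} {a : Fin 3 → ℕ}
    (hw : (x, h, m, a) ∈ GW G c) :
    ∃ E : ℕ ≃ G x, (∀ n, (E n).1 = h n) ∧ ∀ i j, E (m (i, j)) = E i * E j := by
  obtain ⟨h1, h2, h3, h4⟩ := hw
  refine ⟨Equiv.ofBijective (fun n => ⟨h n, (h2 _).2 ⟨n, rfl⟩⟩) ⟨?_, ?_⟩, ?_, ?_⟩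
  · intro i j hij
    exact h1 i j (congrArg Subtype.val hij)
  · rintro ⟨g, hg⟩
    obtain ⟨n, hn⟩ := (h2 g).1 hg
    exact ⟨n, Subtype.ext hn⟩
  · intro n; rfl
  · intro i j
    exact Subtype.ext (h3 i j)

theorem GW_embeds {x x' : X} {h h' : ℕ → 𝒢} {m m' : XGp} {a a' : Fin 3 → ℕ}
    (hw : (x, h, m.1, a) ∈ GW G c) (hw' : (x', h', m'.1, a') ∈ GW G c) :
    GpEmbeds m m' ↔ ∃ φ : G x →* G x', Function.Injective φ := by
  obtain ⟨E, hE, hEm⟩ := GW_equiv hw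
  obtain ⟨E', hE', hEm'⟩ := GW_equiv hw'
  constructor
  · rintro ⟨g, hg, hgm⟩
    refine ⟨MonoidHom.mk' (fun y => E' (g (E.symm y))) ?_, ?_⟩
    · intro y z
      have : y * z = E (m.1 (E.symm y, E.symm z)) := by rw [hEm]; simp
      rw [this, Equiv.symm_apply_apply, hgm, hEm']
    · exact E'.injective.comp (hg.comp E.symm.injective)
  · rintro ⟨φ, hφ⟩
    refine ⟨fun n => E'.symm (φ (E n)), E'.symm.injective.comp (hφ.comp E.injective), ?_⟩
    intro i j
    apply E'.injective
    beta_reduce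
    rw [hEm', hEm]
    simp

theorem GW_inj
    (hc : ∀ x i, c i ∈ G x)
    (hrig : ∀ x y (σ : G x ≃* G y), (∀ i, (σ ⟨c i, hc x i⟩).1 = c i) →
      x = y ∧ ∀ g, (σ g).1 = g.1)
    {x x' : X} {h h' : ℕ → 𝒢} {m : ℕ × ℕ → ℕ} {a : Fin 3 → ℕ}
    (hw : (x, h, m, a) ∈ GW G c) (hw' : (x', h', m, a) ∈ GW G c) : x = x' ∧ h = h' := by
  obtain ⟨E, hE, hEm⟩ := GW_equiv hw
  obtain ⟨E', hE', hEm'⟩ := GW_equiv hw'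
  let σ : G x ≃* G x' :=
    { E.symm.trans E' with
      map_mul' := by
        intro y z
        have : y * z = E (m (E.symm y, E.symm z)) := by rw [hEm]; simp
        simp only [Equiv.toFun_as_coe, Equiv.trans_apply]
        rw [this, Equiv.symm_apply_apply, hEm'] }
  have hσ : ∀ y, σ y = E' (E.symm y) := fun y => rfl
  obtain ⟨r1, r2⟩ := hrig x x' σ (by
    intro i
    have h1 : (⟨c i, hc x i⟩ : G x) = E (a i) := Subtype.ext (by rw [hE]; exact (hw.2.2.2 i).symm)
    rw [h1, hσ, Equiv.symm_apply_apply, hE']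
    exact hw'.2.2.2 i)
  refine ⟨r1, ?_⟩
  funext n
  have := r2 (E n)
  rw [hσ, Equiv.symm_apply_apply, hE, hE'] at this
  exact this.symm

theorem GW_group {x : X} {h : ℕ → 𝒢} {m : ℕ × ℕ → ℕ} {a : Fin 3 → ℕ}
    (hw : (x, h, m, a) ∈ GW G c) : IsGroupOp m := by
  obtain ⟨E, hE, hEm⟩ := GW_equiv hw
  refine ⟨?_, E.symm 1, ?_, ?_⟩
  · intro i j k
    apply E.injective
    simp only [hEm, mul_assoc]
  · intro i
    constructor <;> apply E.injective <;> simp [hEm]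
  · intro i
    refine ⟨E.symm (E i)⁻¹, ?_, ?_⟩ <;> apply E.injective <;> simp [hEm]

theorem GW_iso {x : X} {h : ℕ → 𝒢} {m m' : ℕ × ℕ → ℕ} {a : Fin 3 → ℕ}
    (hw : (x, h, m, a) ∈ GW G c) {g : ℕ → ℕ} (hg : Function.Bijective g)
    (hgm : ∀ x y, g (m (x, y)) = m' (g x, g y)) :
    ∃ h' a', (x, h', m', a') ∈ GW G c := by
  obtain ⟨h1, h2, h3, h4⟩ := hw
  let e := Equiv.ofBijective g hg
  have he : ∀ n, e n = g n := fun n => rfl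
  refine ⟨fun n => h (e.symm n), fun k => e (a k), ?_, ?_, ?_, ?_⟩
  · intro i j hij
    exact e.symm.injective (h1 _ _ hij)
  · intro y
    rw [h2]
    constructor
    · rintro ⟨n, hn⟩; exact ⟨e n, by simpa using hn⟩
    · rintro ⟨n, hn⟩; exact ⟨e.symm n, hn⟩
  · intro i j
    change h (e.symm (m' (i, j))) = h (e.symm i) * h (e.symm j)
    rw [← h3]
    congr 1
    rw [Equiv.symm_apply_eq, he, hgm, ← he, ← he]
    simp
  · intro k
    change h (e.symm (e (a k))) = c k
    simpa using h4 k

theorem measurableSet_GW [MeasurableSpace X] [MeasurableSpace 𝒢] [DiscreteMeasurableSpace 𝒢]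
    [Countable 𝒢] (hmeas : ∀ g, MeasurableSet {x | g ∈ G x}) : MeasurableSet (GW G c) := by
  have hh : ∀ n, Measurable (fun w : X × (ℕ → 𝒢) × (ℕ × ℕ → ℕ) × (Fin 3 → ℕ) => w.2.1 n) := by
    intro n; fun_prop
  have heq : ∀ n g, Measurable
      (fun w : X × (ℕ → 𝒢) × (ℕ × ℕ → ℕ) × (Fin 3 → ℕ) => w.2.1 n = g) := by
    intro n g
    exact measurableSet_setOfPred.1 (hh n (MeasurableSet.of_discrete (s := {g})))
  have hG : ∀ g, Measurable
      (fun w : X × (ℕ → 𝒢) × (ℕ × ℕ → ℕ) × (Fin 3 → ℕ) => g ∈ G w.1) := by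
    intro g
    exact measurableSet_setOfPred.1 (measurable_fst (hmeas g))
  have hmul : ∀ k i j, Measurable
      (fun w : X × (ℕ → 𝒢) × (ℕ × ℕ → ℕ) × (Fin 3 → ℕ) => w.2.1 k = w.2.1 i * w.2.1 j) := by
    intro k i j
    have h1 : Measurable (fun w : X × (ℕ → 𝒢) × (ℕ × ℕ → ℕ) × (Fin 3 → ℕ) =>
      (w.2.1 k, w.2.1 i, w.2.1 j)) := (hh k).prodMk ((hh i).prodMk (hh j))
    exact measurableSet_setOfPred.1 (h1 (MeasurableSet.of_discrete
      (s := {t : 𝒢 × 𝒢 × 𝒢 | t.1 = t.2.1 * t.2.2})))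
  have heq2 : ∀ i j, Measurable
      (fun w : X × (ℕ → 𝒢) × (ℕ × ℕ → ℕ) × (Fin 3 → ℕ) => w.2.1 i = w.2.1 j) := by
    intro i j
    have h1 : Measurable (fun w : X × (ℕ → 𝒢) × (ℕ × ℕ → ℕ) × (Fin 3 → ℕ) =>
      (w.2.1 i, w.2.1 j)) := (hh i).prodMk (hh j)
    exact measurableSet_setOfPred.1 (h1 (MeasurableSet.of_discrete
      (s := {t : 𝒢 × 𝒢 | t.1 = t.2})))
  have hm : ∀ i j k, Measurable
      (fun w : X × (ℕ → 𝒢) × (ℕ × ℕ → ℕ) × (Fin 3 → ℕ) => w.2.2.1 (i, j) = k) := by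
    intro i j k
    have h1 : Measurable (fun w : X × (ℕ → 𝒢) × (ℕ × ℕ → ℕ) × (Fin 3 → ℕ) => w.2.2.1 (i, j)) := by
      fun_prop
    exact measurableSet_setOfPred.1 (h1 (MeasurableSet.of_discrete (s := {k})))
  have ha : ∀ i k, Measurable
      (fun w : X × (ℕ → 𝒢) × (ℕ × ℕ → ℕ) × (Fin 3 → ℕ) => w.2.2.2 i = k) := by
    intro i k
    have h1 : Measurable (fun w : X × (ℕ → 𝒢) × (ℕ × ℕ → ℕ) × (Fin 3 → ℕ) => w.2.2.2 i) := by
      fun_prop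
    exact measurableSet_setOfPred.1 (h1 (MeasurableSet.of_discrete (s := {k})))
  have : GW G c = {w | (∀ i j, w.2.1 i = w.2.1 j → i = j) ∧ (∀ g, g ∈ G w.1 ↔ ∃ n, w.2.1 n = g) ∧
    (∀ i j k, w.2.2.1 (i, j) = k → w.2.1 k = w.2.1 i * w.2.1 j) ∧
      ∀ i k, w.2.2.2 i = k → w.2.1 k = c i} := by
    ext w
    simp [GW]
  rw [this, measurableSet_setOfPred]
  refine Measurable.and ?_ (Measurable.and ?_ (Measurable.and ?_ ?_))
  · exact Measurable.forall fun i => Measurable.forall fun j => (heq2 i j).imp measurable_const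
  · exact Measurable.forall fun g => (hG g).iff (Measurable.exists fun n => heq n g)
  · exact Measurable.forall fun i => Measurable.forall fun j => Measurable.forall fun k =>
      (hm i j k).imp (hmul k i j)
  · exact Measurable.forall fun i => Measurable.forall fun k => (ha i k).imp (heq k (c i))

/-- A measurable enumeration. -/
theorem exists_enum [MeasurableSpace X] [MeasurableSpace 𝒢] [DiscreteMeasurableSpace 𝒢]
    [Countable 𝒢] (hmeas : ∀ g, MeasurableSet {x | g ∈ G x}) (hinf : ∀ x, Infinite (G x)) :
    ∃ h : X → ℕ → 𝒢, (∀ n, Measurable fun x => h x n) ∧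
      ∀ x, (∀ i j, h x i = h x j → i = j) ∧ ∀ g, g ∈ G x ↔ ∃ n, h x n = g := by
  classical
  obtain ⟨e, he⟩ := exists_injective_nat 𝒢
  let p : X → ℕ → Prop := fun x k => ∃ g, e g = k ∧ g ∈ G x
  have hpm : ∀ k, MeasurableSet {x | p x k} := by
    intro k
    rw [measurableSet_setOfPred]
    exact Measurable.exists fun g => (measurable_const).and (measurableSet_setOfPred.1 (hmeas g))
  have hpinf : ∀ x, Set.Infinite {k | p x k} := by
    intro x
    have : {k | p x k} = Set.range (fun g : G x => e g.1) := by
      ext k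
      constructor
      · rintro ⟨g, hg, hx⟩; exact ⟨⟨g, hx⟩, hg⟩
      · rintro ⟨⟨g, hx⟩, hg⟩; exact ⟨g, hg, hx⟩
    rw [this]
    have := hinf x
    apply Set.infinite_range_of_injective
    exact he.comp Subtype.val_injective
  have hcount : ∀ k, Measurable fun x => Nat.count (p x) k := by
    intro k
    induction k with
    | zero => simp
    | succ k ih =>
      simp only [Nat.count_succ]
      exact ih.add (Measurable.ite (hpm k) measurable_const measurable_const)
  have hnth : ∀ n, Measurable fun x => Nat.nth (p x) n := by
    intro n
    apply measurable_to_countable'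
    intro k
    have : (fun x => Nat.nth (p x) n) ⁻¹' {k} =
        {x | p x k} ∩ (fun x => Nat.count (p x) k) ⁻¹' {n} := by
      ext x
      simp only [Set.mem_preimage, Set.mem_singleton_iff, Set.mem_inter_iff, Set.mem_ofPred_eq]
      constructor
      · rintro rfl
        exact ⟨Nat.nth_mem_of_infinite (hpinf x) n, Nat.count_nth_of_infinite (hpinf x) n⟩
      · rintro ⟨h1, rfl⟩
        exact Nat.nth_count h1
    rw [this]
    exact (hpm k).inter (hcount k (MeasurableSet.of_discrete))
  have hinv : ∀ x n, e (Function.invFun e (Nat.nth (p x) n)) = Nat.nth (p x) n := by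
    intro x n
    obtain ⟨g, hg, _⟩ := Nat.nth_mem_of_infinite (hpinf x) n
    exact Function.invFun_eq ⟨g, hg⟩
  refine ⟨fun x n => Function.invFun e (Nat.nth (p x) n), ?_, ?_⟩
  · intro n
    exact (Measurable.of_discrete (f := Function.invFun e)).comp (hnth n)
  · intro x
    constructor
    · intro i j hij
      have := congrArg e hij
      simp only [hinv] at this
      exact Nat.nth_injective (hpinf x) this
    · intro g
      constructor
      · intro hg
        refine ⟨Nat.count (p x) (e g), ?_⟩
        have : p x (e g) := ⟨g, rfl, hg⟩
        simp only [Nat.nth_count this]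
        exact Function.leftInverse_invFun he g
      · rintro ⟨n, rfl⟩
        obtain ⟨g, hg, hgx⟩ := Nat.nth_mem_of_infinite (hpinf x) n
        simp only [← hg, Function.leftInverse_invFun he g]
        exact hgx

end

theorem borel_lemma {X : Type*} [MeasurableSpace X] [StandardBorelSpace X] {𝒢 : Type*} [Group 𝒢]
    [Countable 𝒢] (R : X → X → Prop) (G : X → Subgroup 𝒢)
    (hmeas : ∀ g, MeasurableSet {x | g ∈ G x}) (hinf : ∀ x, Infinite (G x))
    (c : Fin 3 → 𝒢) (hc : ∀ x i, c i ∈ G x)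
    (hrig : ∀ x y (σ : G x ≃* G y), (∀ i, (σ ⟨c i, hc x i⟩).1 = c i) →
      x = y ∧ ∀ g, (σ g).1 = g.1)
    (hR : ∀ x y, R x y ↔ ∃ φ : G x →* G y, Function.Injective φ) :
    ∃ B : Set XGp, MeasurableSet B ∧
      (∀ m m', m ∈ B → GpIso m m' → m' ∈ B) ∧
      BorelBireducible (fun a b : B => GpEmbeds a.1 b.1) R := by
  classical
  let _ : MeasurableSpace 𝒢 := ⊤
  have : DiscreteMeasurableSpace 𝒢 := ⟨fun _ => trivial⟩
  let E : Set X → Set ((ℕ × ℕ → ℕ) × (Fin 3 → ℕ)) := fun U =>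
    (fun w : X × (ℕ → 𝒢) × (ℕ × ℕ → ℕ) × (Fin 3 → ℕ) => w.2.2) '' (GW G c ∩ Prod.fst ⁻¹' U)
  have hE : ∀ U, MeasurableSet U → MeasurableSet (E U) := by
    intro U hU
    apply MeasurableSet.image_of_measurable_injOn
    · exact (measurableSet_GW hmeas).inter (measurable_fst hU)
    · fun_prop
    · rintro ⟨x, h, m, a⟩ ⟨hw, _⟩ ⟨x', h', m', a'⟩ ⟨hw', _⟩ heq
      simp only [Prod.mk.injEq] at heq
      obtain ⟨rfl, rfl⟩ := heq
      obtain ⟨rfl, rfl⟩ := GW_inj hc hrig hw hw'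
      rfl
  have hEi : ∀ U m a, (m, a) ∈ E U ↔ ∃ x h, x ∈ U ∧ (x, h, m, a) ∈ GW G c := by
    intro U m a
    constructor
    · rintro ⟨⟨x, h, m', a'⟩, ⟨h1, h2⟩, h3⟩
      simp only [Prod.mk.injEq] at h3
      obtain ⟨rfl, rfl⟩ := h3
      exact ⟨x, h, h2, h1⟩
    · rintro ⟨x, h, h1, h2⟩
      exact ⟨(x, h, m, a), ⟨h2, h1⟩, rfl⟩
  obtain ⟨u, hu⟩ := exists_surjective_nat (Fin 3 → ℕ)
  let B : Set XGp := {m | ∃ n, (m.1, u n) ∈ E Set.univ}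
  have hBm : MeasurableSet B := by
    have : B = ⋃ n, (fun m : XGp => (m.1, u n)) ⁻¹' E Set.univ := by
      ext m; simp [B]
    rw [this]
    refine MeasurableSet.iUnion fun n => ?_
    exact (measurable_subtype_coe.prodMk measurable_const) (hE _ MeasurableSet.univ)
  have hBi : ∀ m : XGp, m ∈ B ↔ ∃ x h a, (x, h, m.1, a) ∈ GW G c := by
    intro m
    constructor
    · rintro ⟨n, hn⟩
      obtain ⟨x, h, _, hw⟩ := (hEi _ _ _).1 hn
      exact ⟨x, h, _, hw⟩
    · rintro ⟨x, h, a, hw⟩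
      obtain ⟨n, rfl⟩ := hu a
      exact ⟨n, (hEi _ _ _).2 ⟨x, h, trivial, hw⟩⟩
  refine ⟨B, hBm, ?_, ?_, ?_⟩
  · rintro m m' hm ⟨g, hg, hgm⟩
    obtain ⟨x, h, a, hw⟩ := (hBi m).1 hm
    obtain ⟨h', a', hw'⟩ := GW_iso hw hg hgm
    exact (hBi m').2 ⟨x, h', a', hw'⟩
  · have hex : ∀ m : B, ∃ n, (m.1.1, u n) ∈ E Set.univ := fun m => m.2
    let N : B → ℕ := fun m => Nat.find (hex m)
    have hval : Measurable fun m : B => m.1.1 := measurable_subtype_coe.comp measurable_subtype_coe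
    have hN : Measurable N := by
      apply measurable_find
      intro k
      exact (hval.prodMk measurable_const) (hE _ MeasurableSet.univ)
    have hd : ∀ m : B, ∃ x h, (x, h, m.1.1, u (N m)) ∈ GW G c := by
      intro m
      obtain ⟨x, h, _, hw⟩ := (hEi _ _ _).1 (Nat.find_spec (hex m))
      exact ⟨x, h, hw⟩
    choose d h hdw using hd
    refine ⟨d, ?_, ?_⟩
    · intro U hU
      have : d ⁻¹' U = (fun m : B => (m.1.1, u (N m))) ⁻¹' E U := by
        ext m
        simp only [Set.mem_preimage, hEi]
        constructor
        · intro hm; exact ⟨_, _, hm, hdw m⟩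
        · rintro ⟨x, h', hx, hw⟩
          obtain ⟨rfl, _⟩ := GW_inj hc hrig hw (hdw m)
          exact hx
      rw [this]
      exact (hval.prodMk ((Measurable.of_discrete (f := u)).comp hN)) (hE U hU)
    · intro m m'
      rw [hR]
      exact GW_embeds (hdw m) (hdw m')
  · obtain ⟨h, hhm, hh⟩ := exists_enum hmeas hinf
    have hex : ∀ x (ij : ℕ × ℕ), ∃ k, h x k = h x ij.1 * h x ij.2 := by
      intro x ij
      apply ((hh x).2 _).1
      exact mul_mem (((hh x).2 _).2 ⟨_, rfl⟩) (((hh x).2 _).2 ⟨_, rfl⟩)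
    let M : X → ℕ × ℕ → ℕ := fun x ij => Nat.find (hex x ij)
    have hM : ∀ ij, Measurable fun x => M x ij := by
      intro ij
      apply measurable_find
      intro k
      have h1 : Measurable (fun x => (h x k, h x ij.1, h x ij.2)) :=
        (hhm _).prodMk ((hhm _).prodMk (hhm _))
      exact h1 (MeasurableSet.of_discrete (s := {t : 𝒢 × 𝒢 × 𝒢 | t.1 = t.2.1 * t.2.2}))
    have ha : ∀ x, ∃ a : Fin 3 → ℕ, ∀ k, h x (a k) = c k := by
      intro x
      have : ∀ k, ∃ n, h x n = c k := fun k => ((hh x).2 _).1 (hc x k)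
      choose a ha using this
      exact ⟨a, ha⟩
    choose a ha using ha
    have hw : ∀ x, (x, h x, M x, a x) ∈ GW G c := fun x =>
      ⟨(hh x).1, (hh x).2, fun i j => Nat.find_spec (hex x (i, j)), ha x⟩
    let f : X → B := fun x => ⟨⟨M x, GW_group (hw x)⟩, (hBi _).2 ⟨x, h x, a x, hw x⟩⟩
    refine ⟨f, ?_, ?_⟩
    · exact ((measurable_pi_iff.2 hM).subtype_mk).subtype_mk
    · intro x x'
      rw [hR]
      exact (GW_embeds (m := (f x).1) (m' := (f x').1) (hw x) (hw x')).symm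

open GFrame in
theorem final_group {X : Type*} [MeasurableSpace X] [StandardBorelSpace X]
    (R : X → X → Prop) {V : Type} [Countable V] (F : GFrame V) (T : X → Set V)
    (hTi : Function.Injective T) (hcl : ∀ x, ∀ v ∈ T x, F.par v ∈ T x) (hr : ∀ x, F.root ∈ T x)
    (hTm : ∀ v, MeasurableSet {x | v ∈ T x})
    (hR : ∀ x y, R x y ↔ ∃ φ : F.G (T x) →* F.G (T y), Function.Injective φ) :
    ∃ B : Set XGp, MeasurableSet B ∧
      (∀ m m', m ∈ B → GpIso m m' → m' ∈ B) ∧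
      BorelBireducible (fun a b : B => GpEmbeds a.1 b.1) R := by
  have hle : ∀ x, F.G (T x) ≤ F.G Set.univ := fun x => G_mono (Set.subset_univ _)
  have : Countable (F.G (Set.univ : Set V)) := G_countable
  let J : ∀ x, (F.G (T x)).subgroupOf (F.G Set.univ) ≃* F.G (T x) :=
    fun x => Subgroup.subgroupOfEquivOfLe (hle x)
  have hJ : ∀ x g, (J x g).1 = g.1.1 := fun x g => rfl
  have hJs : ∀ x g, ((J x).symm g).1.1 = g.1 := fun x g => rfl
  let c0 : Fin 3 → V → GP := ![tau, iota, incl (Finsupp.single F.root 1)]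
  have hc0 : ∀ x i, c0 i ∈ F.G (T x) := by
    intro x i
    fin_cases i
    · exact tau_mem
    · exact iota_mem
    · exact incl_mem (b_mem (hr x))
  have hc0u : ∀ i, c0 i ∈ F.G Set.univ := by
    intro i
    fin_cases i
    · exact tau_mem
    · exact iota_mem
    · exact incl_mem (b_mem trivial)
  have key : ∀ x y (σ : F.G (T x) ≃* F.G (T y)), (∀ i, (σ ⟨c0 i, hc0 x i⟩).1 = c0 i) →
      T x ⊆ T y ∧ ∀ g, (σ g).1 = g.1 := by
    intro x y σ h
    exact iso_aux σ (Subtype.ext (h 1)) (Subtype.ext (h 0)) (hr x) (hr y) (Subtype.ext (h 2)) (hcl x)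
  apply borel_lemma R (fun x => (F.G (T x)).subgroupOf (F.G Set.univ)) ?_ ?_
    (fun i => ⟨c0 i, hc0u i⟩) (fun x i => hc0 x i) ?_ ?_
  · rintro ⟨g, hg⟩
    have : {x | (⟨g, hg⟩ : F.G Set.univ) ∈ (F.G (T x)).subgroupOf (F.G Set.univ)} =
        ⋃ s : {s : Finset V // g ∈ F.G (s : Set V)}, ⋂ v ∈ s.1, {x | v ∈ T x} := by
      ext x
      have h1 : (⟨g, hg⟩ : F.G Set.univ) ∈ (F.G (T x)).subgroupOf (F.G Set.univ) ↔
        g ∈ F.G (T x) := Iff.rfl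
      simp only [Set.mem_ofPred_eq, h1, mem_G_iff (T := T x), Set.mem_iUnion, Set.mem_iInter]
      constructor
      · rintro ⟨s, hs, h⟩; exact ⟨⟨s, h⟩, fun v hv => hs hv⟩
      · rintro ⟨⟨s, h⟩, hs⟩; exact ⟨s, fun v hv => hs v hv, h⟩
    rw [this]
    refine MeasurableSet.iUnion fun s => ?_
    exact Finset.measurableSet_biInter _ fun v _ => hTm v
  · intro x
    have : Infinite (F.G (T x)) := G_infinite (hr x)
    exact (J x).symm.toEquiv.infinite_iff.1 this
  · intro x y σ h
    let σ' : F.G (T x) ≃* F.G (T y) := ((J x).symm.trans σ).trans (J y)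
    have h' : ∀ i, (σ' ⟨c0 i, hc0 x i⟩).1 = c0 i := by
      intro i
      exact congrArg Subtype.val (h i)
    have h'' : ∀ i, (σ'.symm ⟨c0 i, hc0 y i⟩).1 = c0 i := by
      intro i
      have : (⟨c0 i, hc0 y i⟩ : F.G (T y)) = σ' ⟨c0 i, hc0 x i⟩ := Subtype.ext (h' i).symm
      rw [this, MulEquiv.symm_apply_apply]
    obtain ⟨k1, k2⟩ := key x y σ' h'
    obtain ⟨k3, _⟩ := key y x σ'.symm h''
    refine ⟨hTi (Set.Subset.antisymm k1 k3), ?_⟩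
    intro g
    apply Subtype.ext
    have := k2 (J x g)
    simpa [σ', hJ] using this
  · intro x y
    rw [hR]
    constructor
    · rintro ⟨φ, hφ⟩
      exact ⟨((J y).symm.toMonoidHom.comp φ).comp (J x).toMonoidHom,
        ((J y).symm.injective.comp hφ).comp (J x).injective⟩
    · rintro ⟨φ, hφ⟩
      exact ⟨((J y).toMonoidHom.comp φ).comp (J x).symm.toMonoidHom,
        ((J y).injective.comp hφ).comp (J x).symm.injective⟩

/-! ### The trees -/

/-- restriction of a sequence -/
def rs {β : Type} (a : ℕ → β) (n : ℕ) : List β := (List.range n).map a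

theorem rs_succ {β : Type} (a : ℕ → β) (n : ℕ) : rs a (n + 1) = rs a n ++ [a n] := by
  simp [rs, List.range_succ]

theorem rs_length {β : Type} (a : ℕ → β) (n : ℕ) : (rs a n).length = n := by simp [rs]

theorem rs_take {β : Type} (a : ℕ → β) (n : ℕ) : (rs a (n + 1)).take n = rs a n := by
  rw [rs_succ, List.take_append_of_le_length (by rw [rs_length]), List.take_of_length_le]
  rw [rs_length]

theorem rs_eq_apply {β : Type} {a b : ℕ → β} {n k : ℕ} (h : rs a n = rs b n) (hk : k < n) :
    a k = b k := by
  have := congrArg (fun l => l[k]?) h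
  simpa [rs, hk] using this

/-- A coherent sequence of lists comes from a sequence. -/
theorem exists_rs {β : Type} (u : ℕ → List β) (hl : ∀ n, (u n).length = n)
    (hc : ∀ n, (u (n + 1)).take n = u n) : ∃ a : ℕ → β, ∀ n, u n = rs a n := by
  refine ⟨fun n => (u (n + 1))[n]'(by rw [hl]; omega), ?_⟩
  intro n
  induction n with
  | zero => exact List.length_eq_zero_iff.1 (hl 0)
  | succ n ih =>
    rw [rs_succ, ← ih, ← hc n]
    have h1 : n < (u (n + 1)).length := by rw [hl]; omega
    rw [List.take_append_getElem h1]
    rw [List.take_of_length_le (by rw [hl])]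

abbrev Node := Option (ℕ × List Bool × List (List ℕ × List Bool))

def tk (n : ℕ) (p : List ℕ × List Bool) : List ℕ × List Bool := (p.1.take n, p.2.take n)

def nlev : Node → ℕ
  | none => 0
  | some (n, _, _) => n + 1

def npar : Node → Node
  | none => none
  | some (0, _, _) => none
  | some (n + 1, s, l) => some (n, s.take n, l.map (tk n))

def nle : Node → Node → Prop
  | none, none => True
  | none, some _ => False
  | some _, none => False
  | some (n, s, l), some (n', s', l') => n = n' ∧ s = s' ∧ l <+: l'

noncomputable def nframe : GFrame Node where
  le := nle
  lev := nlev
  par := npar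
  root := none
  z := some (0, [true], [])
  pr := fun x => Nat.nth Nat.Prime (Encodable.encode x + 1)
  le_refl := by
    rintro (_ | ⟨n, s, l⟩)
    · trivial
    · exact ⟨rfl, rfl, List.prefix_rfl⟩
  le_trans := by
    rintro (_ | ⟨n, s, l⟩) (_ | ⟨n', s', l'⟩) (_ | ⟨n'', s'', l''⟩) <;> simp only [nle] <;> try tauto
    rintro ⟨rfl, rfl, h⟩ ⟨rfl, rfl, h'⟩
    exact ⟨rfl, rfl, h.trans h'⟩
  le_antisymm := by
    rintro (_ | ⟨n, s, l⟩) (_ | ⟨n', s', l'⟩) <;> simp only [nle] <;> try tauto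
    rintro ⟨rfl, rfl, h⟩ ⟨_, _, h'⟩
    rw [h.eq_of_length (le_antisymm h.length_le h'.length_le)]
  le_lev := by
    rintro (_ | ⟨n, s, l⟩) (_ | ⟨n', s', l'⟩) <;> simp only [nle] <;> try tauto
    rintro ⟨rfl, rfl, h⟩
    rfl
  lev_par := by
    rintro (_ | ⟨_ | n, s, l⟩) m h
    · simp [nlev] at h
    · simp only [nlev] at h ⊢
      simp only [npar]
      omega
    · simpa [nlev, npar] using h
  lev_zero := by
    rintro (_ | ⟨n, s, l⟩) h
    · rfl
    · simp [nlev] at h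
  lev_root := rfl
  pr_prime := fun x => Nat.prime_nth_prime _
  pr_inj := by
    intro x y h
    have := Nat.nth_injective Nat.infinite_setOfPred_prime h
    simpa using this
  pr_odd := by
    intro x h
    have h2 : Nat.nth Nat.Prime 0 = 2 := Nat.nth_prime_zero_eq_two
    rw [← h2] at h
    have := Nat.nth_injective Nat.infinite_setOfPred_prime h
    simp at this

section
variable (c1 c2 : (ℕ → ℕ) → ℕ → Bool)

def S0 (n : ℕ) (s : List Bool) (u : List ℕ) (t : List Bool) : Prop :=
  ∃ β, s = rs (c1 β) n ∧ u = rs β n ∧ t = rs (c2 β) n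

def ok (n : ℕ) (x : ℕ → Bool) : List Bool → List (List ℕ × List Bool) → Prop
  | s, [] => s = rs x n
  | s, (u, t) :: l => S0 c1 c2 n s u t ∧ ok n x t l

def tree (x : ℕ → Bool) : Set Node := {v | ∀ n s l, v = some (n, s, l) → ok c1 c2 n x s l}

variable {c1 c2}

theorem mem_tree_some {x : ℕ → Bool} {n s l} : some (n, s, l) ∈ tree c1 c2 x ↔ ok c1 c2 n x s l := by
  constructor
  · intro h; exact h n s l rfl
  · intro h n' s' l' e
    simp only [Option.some.injEq, Prod.mk.injEq] at e
    obtain ⟨rfl, rfl, rfl⟩ := e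
    exact h

theorem none_mem_tree {x : ℕ → Bool} : none ∈ tree c1 c2 x := by
  intro n s l h; simp at h

theorem S0_take {n s u t} (h : S0 c1 c2 (n + 1) s u t) :
    S0 c1 c2 n (s.take n) (u.take n) (t.take n) := by
  obtain ⟨β, rfl, rfl, rfl⟩ := h
  exact ⟨β, rs_take _ _, rs_take _ _, rs_take _ _⟩

theorem ok_take {n : ℕ} {x : ℕ → Bool} {s l} (h : ok c1 c2 (n + 1) x s l) :
    ok c1 c2 n x (s.take n) (l.map (tk n)) := by
  induction l generalizing s with
  | nil =>
    have : s = rs x (n + 1) := h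
    subst this
    exact rs_take _ _
  | cons p l ih =>
    obtain ⟨u, t⟩ := p
    exact ⟨S0_take h.1, ih h.2⟩

theorem tree_par {x : ℕ → Bool} {v : Node} (h : v ∈ tree c1 c2 x) : npar v ∈ tree c1 c2 x := by
  rcases v with (_ | ⟨_ | n, s, l⟩)
  · exact h
  · exact none_mem_tree
  · exact mem_tree_some.2 (ok_take (mem_tree_some.1 h))

theorem z_notMem {x : ℕ → Bool} : (some (0, [true], []) : Node) ∉ tree c1 c2 x := by
  rw [mem_tree_some]
  intro h
  have : [true] = rs x 0 := h
  simp [rs] at this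

theorem tree_inj {x y : ℕ → Bool} (h : tree c1 c2 x = tree c1 c2 y) : x = y := by
  funext k
  have h1 : (some (k + 1, rs x (k + 1), []) : Node) ∈ tree c1 c2 x := mem_tree_some.2 rfl
  rw [h] at h1
  have h2 : rs x (k + 1) = rs y (k + 1) := mem_tree_some.1 h1
  exact rs_eq_apply h2 (Nat.lt_succ_self k)

theorem ok_append {n : ℕ} {x y : ℕ → Bool} {s l u} (h : ok c1 c2 n x s l)
    (h2 : S0 c1 c2 n (rs x n) u (rs y n)) : ok c1 c2 n y s (l ++ [(u, rs y n)]) := by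
  induction l generalizing s with
  | nil =>
    have : s = rs x n := h
    subst this
    exact ⟨h2, rfl⟩
  | cons p l ih =>
    obtain ⟨u, t⟩ := p
    exact ⟨h.1, ih h.2⟩

def ni (α : ℕ → ℕ) (y : ℕ → Bool) : Node → Node
  | none => none
  | some (n, s, l) => some (n, s, l ++ [(rs α n, rs y n)])

theorem measurable_tree {X : Type*} [MeasurableSpace X] (e : X → ℕ → Bool) (he : Measurable e)
    (v : Node) : MeasurableSet {x | v ∈ tree c1 c2 (e x)} := by
  rcases v with (_ | ⟨n, s, l⟩)
  · have : {x | (none : Node) ∈ tree c1 c2 (e x)} = Set.univ :=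
      Set.eq_univ_of_forall fun x => none_mem_tree
    rw [this]; exact MeasurableSet.univ
  · simp only [mem_tree_some]
    induction l generalizing s with
    | nil =>
      have : {x | ok c1 c2 n (e x) s []} =
          {x | ∀ i : ℕ, s[i]? = if i < n then some (e x i) else none} := by
        ext x
        change s = rs (e x) n ↔ _
        rw [List.ext_getElem?_iff]
        apply forall_congr'
        intro i
        simp only [rs, List.getElem?_map]
        by_cases hi : i < n
        · simp [hi]
        · simp [hi]
      rw [this, measurableSet_setOfPred]
      refine Measurable.forall fun i => ?_
      have hi : Measurable fun x => e x i := (measurable_pi_apply i).comp he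
      exact measurableSet_setOfPred.1 (hi (MeasurableSet.of_discrete
        (s := {b : Bool | s[i]? = if i < n then some b else none})))
    | cons p l ih =>
      obtain ⟨u, t⟩ := p
      have : {x | ok c1 c2 n (e x) s ((u, t) :: l)} =
        {x | S0 c1 c2 n s u t} ∩ {x | ok c1 c2 n (e x) t l} := rfl
      rw [this]
      exact (MeasurableSet.const _).inter (ih t)

theorem rs_tendsto {β : Type} [TopologicalSpace β] {a : ℕ → ℕ → β} {b : ℕ → β}
    (h : ∀ n, rs (a n) n = rs b n) : Filter.Tendsto a Filter.atTop (nhds b) := by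
  rw [tendsto_pi_nhds]
  intro k
  apply tendsto_const_nhds.congr'
  filter_upwards [Filter.eventually_gt_atTop k] with n hn
  exact (rs_eq_apply (h n) hn).symm

theorem S0_closed (h1 : Continuous c1) (h2 : Continuous c2) {α : ℕ → ℕ} {a b : ℕ → Bool}
    (h : ∀ n, S0 c1 c2 n (rs a n) (rs α n) (rs b n)) : c1 α = a ∧ c2 α = b := by
  choose β hβ using h
  have hα : Filter.Tendsto β Filter.atTop (nhds α) := rs_tendsto fun n => (hβ n).2.1.symm
  constructor
  · exact tendsto_nhds_unique ((h1.tendsto α).comp hα) (rs_tendsto fun n => (hβ n).1.symm)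
  · exact tendsto_nhds_unique ((h2.tendsto α).comp hα) (rs_tendsto fun n => (hβ n).2.2.symm)

theorem chain {X : Type*} (R : X → X → Prop) (hqo : IsQuasiOrder R) (e : X → ℕ → Bool)
    (he : Function.Injective e) (h1 : Continuous c1) (h2 : Continuous c2)
    (hc : ∀ α, ∃ x y, R x y ∧ c1 α = e x ∧ c2 α = e y) (y : X) (k : ℕ) :
    ∀ (x : X) (l : ℕ → List (List ℕ × List Bool)), (∀ n, (l n).length = k) →
      (∀ n, (l (n + 1)).map (tk n) = l n) → (∀ n, ok c1 c2 n (e y) (rs (e x) n) (l n)) → R x y := by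
  induction k with
  | zero =>
    intro x l hl _ hok
    have : e x = e y := by
      funext k
      have h3 := hok (k + 1)
      rw [List.length_eq_zero_iff.1 (hl _)] at h3
      exact rs_eq_apply h3 (Nat.lt_succ_self k)
    rw [he this]
    exact hqo.1 y
  | succ k ih =>
    intro x l hl hcoh hok
    have hex : ∀ n, ∃ u t l', l n = (u, t) :: l' := by
      intro n
      obtain ⟨p, l', h⟩ := List.exists_cons_of_length_eq_add_one (hl n)
      exact ⟨p.1, p.2, l', h⟩
    choose u t l' hl' using hex
    have hS : ∀ n, S0 c1 c2 n (rs (e x) n) (u n) (t n) := by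
      intro n
      have := hok n
      rw [hl'] at this
      exact this.1
    have hok' : ∀ n, ok c1 c2 n (e y) (t n) (l' n) := by
      intro n
      have := hok n
      rw [hl'] at this
      exact this.2
    have hco : ∀ n, (u (n + 1)).take n = u n ∧ (t (n + 1)).take n = t n ∧
        (l' (n + 1)).map (tk n) = l' n := by
      intro n
      have := hcoh n
      rw [hl', hl'] at this
      simp only [List.map_cons, List.cons.injEq, tk, Prod.mk.injEq] at this
      exact ⟨this.1.1, this.1.2, this.2⟩
    obtain ⟨α, hα⟩ := exists_rs u (fun n => by
      obtain ⟨β, _, h, _⟩ := hS n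
      rw [h, rs_length]) (fun n => (hco n).1)
    obtain ⟨b, hb⟩ := exists_rs t (fun n => by
      obtain ⟨β, _, _, h⟩ := hS n
      rw [h, rs_length]) (fun n => (hco n).2.1)
    obtain ⟨e1, e2⟩ := S0_closed h1 h2 (α := α) (a := e x) (b := b) (by
      intro n
      rw [← hα, ← hb]; exact hS n)
    obtain ⟨x', y', hR, e3, e4⟩ := hc α
    have hx : x' = x := he (by rw [← e3, e1])
    subst hx
    have hb' : b = e y' := by rw [← e4, e2]
    refine hqo.2 hR (ih y' l' ?_ (fun n => (hco n).2.2) ?_)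
    · intro n
      have := hl n
      rw [hl'] at this
      simpa using this
    · intro n
      rw [← hb', ← hb]
      exact hok' n

end

open GFrame in
theorem tree_red {X : Type*} (R : X → X → Prop) (hqo : IsQuasiOrder R) (e : X → ℕ → Bool)
    (he : Function.Injective e) {c1 c2 : (ℕ → ℕ) → ℕ → Bool} (h1 : Continuous c1)
    (h2 : Continuous c2)
    (hc : ∀ α, ∃ x y, R x y ∧ c1 α = e x ∧ c2 α = e y)
    (hc' : ∀ x y, R x y → ∃ α, c1 α = e x ∧ c2 α = e y) (x y : X) :
    R x y ↔ ∃ φ : nframe.G (tree c1 c2 (e x)) →* nframe.G (tree c1 c2 (e y)),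
      Function.Injective φ := by
  constructor
  · intro hR
    obtain ⟨α, ha, hb⟩ := hc' x y hR
    apply embeds (F := nframe) (ni α (e y))
    · rintro (_ | ⟨n, s, l⟩) (_ | ⟨n', s', l'⟩) h
      · rfl
      · simp [ni] at h
      · simp [ni] at h
      · simp only [ni, Option.some.injEq, Prod.mk.injEq] at h
        obtain ⟨rfl, rfl, h⟩ := h
        rw [List.append_cancel_right h]
    · rintro (_ | ⟨n, s, l⟩) <;> rfl
    · rintro (_ | ⟨_ | n, s, l⟩)
      · rfl
      · rfl
      · change some (n, s.take n, (l ++ [(rs α (n + 1), rs (e y) (n + 1))]).map (tk n)) =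
          some (n, s.take n, l.map (tk n) ++ [(rs α n, rs (e y) n)])
        simp [tk, rs_take]
    · rintro (_ | ⟨n, s, l⟩)
      · trivial
      · exact ⟨rfl, rfl, List.prefix_append _ _⟩
    · rintro (_ | ⟨n, s, l⟩) hv
      · exact none_mem_tree
      · apply mem_tree_some.2
        exact ok_append (mem_tree_some.1 hv) ⟨α, by rw [ha], rfl, by rw [hb]⟩
    · exact z_notMem
    · exact z_notMem
  · rintro ⟨φ, hφ⟩
    let v : ℕ → Node := fun n => match n with
      | 0 => none
      | n + 1 => some (n, rs (e x) n, [])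
    obtain ⟨w, hw1, hw2, hw3⟩ := exists_branch φ hφ v
      (by
        rintro (_ | n)
        · rfl
        · change some (n, (rs (e x) (n + 1)).take n, _) = some (n, rs (e x) n, [])
          rw [rs_take]; rfl)
      (by rintro (_ | n) <;> rfl)
      (by
        rintro (_ | n)
        · exact none_mem_tree
        · exact mem_tree_some.2 rfl)
    have hex : ∀ n, ∃ l, w (n + 1) = some (n, rs (e x) n, l) := by
      intro n
      have h3 : nle (some (n, rs (e x) n, [])) (w (n + 1)) := hw2 (n + 1)
      rcases hwn : w (n + 1) with (_ | ⟨n', s', l'⟩)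
      · rw [hwn] at h3
        exact h3.elim
      · rw [hwn] at h3
        obtain ⟨rfl, rfl, _⟩ := h3
        exact ⟨l', rfl⟩
    choose l hl using hex
    have hcoh : ∀ n, (l (n + 1)).map (tk n) = l n := by
      intro n
      have h3 : npar (w (n + 1 + 1)) = w (n + 1) := hw3 (n + 1)
      rw [hl, hl] at h3
      simp only [npar, Option.some.injEq, Prod.mk.injEq] at h3
      exact h3.2.2
    have hlen : ∀ n, (l n).length = (l 0).length := by
      intro n
      induction n with
      | zero => rfl
      | succ n ih => rw [← ih, ← hcoh n, List.length_map]
    refine chain R hqo e he h1 h2 hc y (l 0).length x l hlen hcoh ?_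
    intro n
    have := hw1 (n + 1)
    rw [hl] at this
    exact mem_tree_some.1 this

/-- **Invariant universality of embeddability between countable groups.**
For every analytic quasi-order `R` on a standard Borel space `X` there is a Borel subset
`B ⊆ X_Gp`, invariant under isomorphism `≅_Gp`, such that the restriction of `⊑_Gp` to `B`
is Borel bi-reducible with `R`. -/
theorem gpEmbeds_invariantly_universal {X : Type*} [MeasurableSpace X] [StandardBorelSpace X]
    (R : X → X → Prop) (hqo : IsQuasiOrder R) (han : IsAnalyticRel R) :
    ∃ B : Set XGp, MeasurableSet B ∧
      (∀ m m', m ∈ B → GpIso m m' → m' ∈ B) ∧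
      BorelBireducible (fun a b : B => GpEmbeds a.1 b.1) R := by
  rcases isEmpty_or_nonempty X with hX | ⟨⟨x0⟩⟩
  · refine ⟨∅, MeasurableSet.empty, fun m m' h => h.elim, ⟨fun b => b.2.elim, ?_, ?_⟩,
      ⟨fun x => isEmptyElim x, ?_, ?_⟩⟩
    · exact measurable_of_empty _
    · exact fun b => b.2.elim
    · exact measurable_of_empty _
    · exact fun x => isEmptyElim x
  · obtain ⟨e, hem, he⟩ : ∃ e : X → ℕ → Bool, Measurable e ∧ Function.Injective e :=
      ⟨_, MeasurableSpace.measurable_mapNatBool X, MeasurableSpace.injective_mapNatBool X⟩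
    have hne : {p : X × X | R p.1 p.2}.Nonempty := ⟨(x0, x0), hqo.1 x0⟩
    obtain ⟨f, hf, hfr⟩ := han.resolve_left hne.ne_empty
    let g : (ℕ → ℕ) → (ℕ → Bool) × (ℕ → Bool) := fun α => (e (f α).1, e (f α).2)
    have hg : Measurable g :=
      (hem.comp (measurable_fst.comp hf)).prodMk (hem.comp (measurable_snd.comp hf))
    have hga : MeasureTheory.AnalyticSet (g '' Set.univ) :=
      MeasurableSet.univ.analyticSet_image hg
    rw [MeasureTheory.AnalyticSet] at hga
    obtain ⟨c, hcc, hcr⟩ := hga.resolve_left (by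
      rw [Set.image_univ]; exact (Set.range_nonempty g).ne_empty)
    rw [Set.image_univ] at hcr
    have hc : ∀ α, ∃ x y, R x y ∧ (c α).1 = e x ∧ (c α).2 = e y := by
      intro α
      have : c α ∈ Set.range g := hcr ▸ ⟨α, rfl⟩
      obtain ⟨β, hβ⟩ := this
      have h1 : f β ∈ {p : X × X | R p.1 p.2} := hfr ▸ ⟨β, rfl⟩
      exact ⟨(f β).1, (f β).2, h1, by rw [← hβ], by rw [← hβ]⟩
    have hc' : ∀ x y, R x y → ∃ α, (c α).1 = e x ∧ (c α).2 = e y := by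
      intro x y hxy
      have h1 : (x, y) ∈ Set.range f := by rw [hfr]; exact hxy
      obtain ⟨β, hβ⟩ := h1
      have h2 : g β ∈ Set.range c := hcr ▸ ⟨β, rfl⟩
      obtain ⟨α, hα⟩ := h2
      refine ⟨α, ?_, ?_⟩
      · rw [hα]; simp [g, hβ]
      · rw [hα]; simp [g, hβ]
    apply final_group R nframe
      (fun x => tree (fun α => (c α).1) (fun α => (c α).2) (e x))
    · intro x y h
      exact he (tree_inj h)
    · intro x v hv
      exact tree_par hv
    · intro x
      exact none_mem_tree
    · intro v
      exact measurable_tree e hem v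
    · exact tree_red R hqo e he (continuous_fst.comp hcc) (continuous_snd.comp hcc) hc hc'
end

section
/- The embeddability relation ⊑_Gp on X_Gp is a complete analytic quasi-order: ⊑_Gp is an analytic quasi-order on X_Gp, and every analytic quasi-order R on a standard Borel space X satisfies R ≤_B ⊑_Gp. -/
namespace GpE

open MeasureTheory Filter Topology

/-! ### Analyticity -/

lemma measurableSet_isGroupOp : MeasurableSet {m : ℕ × ℕ → ℕ | IsGroupOp m} := by
  have hev : ∀ a b c : ℕ, MeasurableSet {m : ℕ × ℕ → ℕ | m (a, b) = c} := fun a b c =>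
    measurableSet_eq_fun (measurable_pi_apply (a, b)) measurable_const
  have h1 : {m : ℕ × ℕ → ℕ | IsGroupOp m} =
      (⋂ a, ⋂ b, ⋂ c, ⋃ d, ⋃ e, ⋃ f, {m : ℕ × ℕ → ℕ | m (a, b) = d} ∩ {m | m (b, c) = e} ∩
        {m | m (d, c) = f} ∩ {m | m (a, e) = f}) ∩
      ⋃ e, ((⋂ a, {m | m (e, a) = a} ∩ {m | m (a, e) = a}) ∩
        ⋂ a, ⋃ b, {m | m (a, b) = e} ∩ {m | m (b, a) = e}) := by
    ext m
    simp only [IsGroupOp, Set.mem_ofPred_eq, Set.mem_inter_iff, Set.mem_iInter, Set.mem_iUnion]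
    refine and_congr ?_ Iff.rfl
    refine forall_congr' fun a => forall_congr' fun b => forall_congr' fun c => ?_
    constructor
    · intro h
      exact ⟨_, _, _, ⟨⟨rfl, rfl⟩, rfl⟩, h.symm⟩
    · rintro ⟨d, e, f, ⟨⟨rfl, rfl⟩, rfl⟩, h⟩
      exact h.symm
  rw [h1]
  refine MeasurableSet.inter ?_ ?_
  · refine .iInter fun a => .iInter fun b => .iInter fun c => .iUnion fun d => .iUnion fun e =>
      .iUnion fun f => (((hev _ _ _).inter (hev _ _ _)).inter (hev _ _ _)).inter (hev _ _ _)
  · refine .iUnion fun e => .inter (.iInter fun a => (hev _ _ _).inter (hev _ _ _))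
      (.iInter fun a => .iUnion fun b => (hev _ _ _).inter (hev _ _ _))

lemma isAnalyticRel_gpEmbeds : IsAnalyticRel GpEmbeds := by
  have : StandardBorelSpace XGp := measurableSet_isGroupOp.standardBorel
  have : SecondCountableTopology XGp :=
    TopologicalSpace.Subtype.secondCountableTopology {m : ℕ × ℕ → ℕ | IsGroupOp m}
  have : BorelSpace XGp := Subtype.borelSpace {m : ℕ × ℕ → ℕ | IsGroupOp m}
  let S : Set (XGp × XGp × (ℕ → ℕ)) := {p | Function.Injective p.2.2 ∧
    ∀ x y, p.2.2 (p.1.1 (x, y)) = p.2.1.1 (p.2.2 x, p.2.2 y)}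
  have hg : ∀ a b : ℕ, MeasurableSet {p : XGp × XGp × (ℕ → ℕ) | p.2.2 a = b} := fun a b =>
    measurableSet_eq_fun ((measurable_pi_apply a).comp (measurable_snd.comp measurable_snd))
      measurable_const
  have h1 : ∀ a b c : ℕ, MeasurableSet {p : XGp × XGp × (ℕ → ℕ) | p.1.1 (a, b) = c} :=
    fun a b c => measurableSet_eq_fun
      ((measurable_pi_apply (a, b)).comp (measurable_subtype_coe.comp measurable_fst))
      measurable_const
  have h2 : ∀ a b c : ℕ, MeasurableSet {p : XGp × XGp × (ℕ → ℕ) | p.2.1.1 (a, b) = c} :=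
    fun a b c => measurableSet_eq_fun ((measurable_pi_apply (a, b)).comp
      (measurable_subtype_coe.comp (measurable_fst.comp measurable_snd)))
      measurable_const
  have hS : MeasurableSet S := by
    have : S = (⋂ a, ⋂ b, ⋂ c, ⋂ (_ : a ≠ b),
          ({p : XGp × XGp × (ℕ → ℕ) | p.2.2 a = c} ∩ {p | p.2.2 b = c})ᶜ) ∩
        ⋂ x, ⋂ y, ⋃ a, ⋃ b, ⋃ c, ⋃ d, {p | p.1.1 (x, y) = a} ∩ {p | p.2.2 x = b} ∩
          {p | p.2.2 y = c} ∩ {p | p.2.2 a = d} ∩ {p | p.2.1.1 (b, c) = d} := by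
      ext p
      simp only [S, Set.mem_ofPred_eq, Set.mem_inter_iff, Set.mem_iInter, Set.mem_iUnion,
        Set.mem_compl_iff]
      refine and_congr ?_ ?_
      · constructor
        · rintro h a b c hab ⟨h3, h4⟩
          exact hab (h (h3.trans h4.symm))
        · intro h a b hab
          by_contra hne
          exact h a b _ hne ⟨hab, rfl⟩
      · refine forall_congr' fun a => forall_congr' fun b => ?_
        constructor
        · intro h
          exact ⟨_, _, _, _, ⟨⟨⟨rfl, rfl⟩, rfl⟩, rfl⟩, h.symm⟩
        · rintro ⟨d, e, f, g, ⟨⟨⟨rfl, rfl⟩, rfl⟩, rfl⟩, h⟩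
          exact h.symm
    rw [this]
    refine .inter ?_ ?_
    · exact .iInter fun a => .iInter fun b => .iInter fun c => .iInter fun _ =>
        ((hg _ _).inter (hg _ _)).compl
    · exact .iInter fun a => .iInter fun b => .iUnion fun c => .iUnion fun _ => .iUnion fun _ =>
        .iUnion fun _ => ((((h1 _ _ _).inter (hg _ _)).inter (hg _ _)).inter (hg _ _)).inter
          (h2 _ _ _)
  let f : XGp × XGp × (ℕ → ℕ) → XGp × XGp := fun p => (p.1, p.2.1)
  have hf : Measurable f := measurable_fst.prodMk (measurable_fst.comp measurable_snd)
  have hA : AnalyticSet (f '' S) := hS.analyticSet_image hf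
  have hE : f '' S = {p : XGp × XGp | GpEmbeds p.1 p.2} := by
    ext ⟨m, m'⟩
    constructor
    · rintro ⟨⟨a, b, g⟩, h, he⟩
      obtain ⟨rfl, rfl⟩ := Prod.mk.inj he
      exact ⟨g, h⟩
    · rintro ⟨g, h⟩
      exact ⟨(m, m', g), h, rfl⟩
  rw [hE, AnalyticSet] at hA
  rcases hA with h | ⟨g, hg, hr⟩
  · exact Or.inl h
  · exact Or.inr ⟨g, hg.measurable, hr⟩

lemma isQuasiOrder_gpEmbeds : IsQuasiOrder GpEmbeds := by
  refine ⟨fun m => ⟨id, Function.injective_id, fun _ _ => rfl⟩, ?_⟩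
  rintro a b c ⟨g, hg, h⟩ ⟨g', hg', h'⟩
  exact ⟨g' ∘ g, hg'.comp hg, fun x y => by simp [h, h']⟩

/-! ### Combinatorics of the tree representation -/

/-- The reversed list of the first `n` values of `x`. -/
def pre {α : Type*} (x : ℕ → α) : ℕ → List α
  | 0 => []
  | n + 1 => x n :: pre x n

@[simp] lemma pre_length {α : Type*} (x : ℕ → α) (n : ℕ) : (pre x n).length = n := by
  induction n with
  | zero => rfl
  | succ n ih => simp [pre, ih]

lemma pre_eq_iff {α : Type*} {x y : ℕ → α} {n : ℕ} : pre x n = pre y n ↔ ∀ i < n, x i = y i := by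
  induction n with
  | zero => simp [pre]
  | succ n ih =>
    simp only [pre, List.cons.injEq, ih]
    constructor
    · rintro ⟨h1, h2⟩ i hi
      rcases Nat.lt_succ_iff_lt_or_eq.1 hi with h | rfl
      · exact h2 i h
      · exact h1
    · intro h
      exact ⟨h n (by omega), fun i hi => h i (by omega)⟩

lemma pre_le {w z : ℕ → ℕ} {n : ℕ} (h : List.Forall₂ (· ≤ ·) (pre w n) (pre z n)) :
    ∀ i < n, w i ≤ z i := by
  induction n with
  | zero => simp
  | succ n ih =>
    simp only [pre, List.forall₂_cons] at h
    intro i hi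
    rcases Nat.lt_succ_iff_lt_or_eq.1 hi with h' | rfl
    · exact ih h.2 i h'
    · exact h.1

/-- Pointwise addition of (an initial segment of) `z` to a reversed list. -/
def shift (z : ℕ → ℕ) : List ℕ → List ℕ
  | [] => []
  | i :: s => (i + z s.length) :: shift z s

@[simp] lemma shift_length (z : ℕ → ℕ) (s : List ℕ) : (shift z s).length = s.length := by
  induction s with
  | nil => rfl
  | cons a s ih => simp [shift, ih]

lemma shift_injective (z : ℕ → ℕ) : Function.Injective (shift z) := by
  intro s
  induction s with
  | nil =>
    intro t h
    cases t with
    | nil => rfl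
    | cons a t => simp [shift] at h
  | cons a s ih =>
    intro t h
    cases t with
    | nil => simp [shift] at h
    | cons b t =>
      simp only [shift, List.cons.injEq] at h
      obtain rfl := ih h.2
      simpa using h.1

lemma le_shift_left {r : List ℕ} {z : ℕ → ℕ} {s : List ℕ} (h : List.Forall₂ (· ≤ ·) r s) :
    List.Forall₂ (· ≤ ·) r (shift z s) := by
  induction h with
  | nil => exact .nil
  | cons h _ ih => exact .cons (by omega) ih

lemma le_shift_right {w : ℕ → ℕ} {z : ℕ → ℕ} {s : List ℕ}
    (h : List.Forall₂ (· ≤ ·) (pre w s.length) (pre z s.length)) :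
    List.Forall₂ (· ≤ ·) (pre w s.length) (shift z s) := by
  induction s with
  | nil => exact .nil
  | cons a s ih =>
    simp only [List.length_cons, pre, List.forall₂_cons] at h
    simp only [List.length_cons, pre, shift, List.forall₂_cons]
    exact ⟨by omega, ih h.2⟩

/-- One-step approximation of the relation. -/
def Gr (F : (ℕ → ℕ) → (ℕ → Bool) × (ℕ → Bool)) (s : List ℕ) (u v : List Bool) : Prop :=
  ∃ w, pre (F w).1 s.length = u ∧ pre (F w).2 s.length = v ∧
    List.Forall₂ (· ≤ ·) (pre w s.length) s

/-- `k`-step chains. -/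
def Ch {α : Type*} (r : α → α → Prop) : ℕ → α → α → Prop
  | 0, u, v => u = v
  | k + 1, u, v => ∃ u', r u u' ∧ Ch r k u' v

lemma Ch.mono {α : Type*} {r r' : α → α → Prop} (h : ∀ u v, r u v → r' u v) {k : ℕ} :
    ∀ {u v : α}, Ch r k u v → Ch r' k u v := by
  induction k with
  | zero => exact fun h => h
  | succ k ih =>
    rintro u v ⟨u', h1, h2⟩
    exact ⟨u', h _ _ h1, ih h2⟩

lemma Ch.snoc {α : Type*} {r : α → α → Prop} {k : ℕ} :
    ∀ {u v w : α}, Ch r k u v → r v w → Ch r (k + 1) u w := by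
  induction k with
  | zero => rintro u v w rfl h; exact ⟨w, h, rfl⟩
  | succ k ih =>
    rintro u v w ⟨u', h1, h2⟩ h
    exact ⟨u', h1, ih h2 h⟩

/-- Nodes of the forest. -/
abbrev Node := ℕ × List ℕ

/-- The labels attached to a node. -/
def Lab (F : (ℕ → ℕ) → (ℕ → Bool) × (ℕ → Bool)) (x : ℕ → Bool) (u : List Bool) (t : Node) : Prop :=
  u.length = t.2.length ∧ Ch (Gr F t.2) t.1 u (pre x t.2.length)

lemma lab_shift {F : (ℕ → ℕ) → (ℕ → Bool) × (ℕ → Bool)} {x y : ℕ → Bool} {w : ℕ → ℕ}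
    (hw : F w = (x, y)) {u : List Bool} {t : Node} (h : Lab F x u t) :
    Lab F y u (t.1 + 1, shift w t.2) := by
  refine ⟨by simpa using h.1, ?_⟩
  simp only [shift_length]
  refine Ch.snoc (v := pre x t.2.length) (h.2.mono ?_) ?_
  · rintro u v ⟨w', h1, h2, h3⟩
    exact ⟨w', by simpa using h1, by simpa using h2, by simpa using le_shift_left h3⟩
  · refine ⟨w, by simp [hw], by simp [hw], ?_⟩
    rw [shift_length]
    refine le_shift_right ?_
    simp [List.forall₂_same]

lemma lab_zero (F : (ℕ → ℕ) → (ℕ → Bool) × (ℕ → Bool)) (x : ℕ → Bool) (n : ℕ) :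
    Lab F x (pre x n) (0, pre (fun _ => 0) n) := by
  simp [Lab, Ch]

lemma tendsto_of_agree {α : Type*} [TopologicalSpace α] {U : Ultrafilter ℕ} (hU : (U : Filter ℕ) ≤ cofinite)
    {a b : ℕ → ℕ → α} {x : ℕ → α} (hab : ∀ n, pre (a n) n = pre (b n) n)
    (ha : Tendsto a U (𝓝 x)) : Tendsto b U (𝓝 x) := by
  rw [tendsto_pi_nhds] at ha ⊢
  intro i
  refine (ha i).congr' ?_
  have : ∀ᶠ n in cofinite, i < n := by
    rw [Nat.cofinite_eq_atTop]; exact eventually_gt_atTop i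
  filter_upwards [hU this] with n hn
  exact pre_eq_iff.1 (hab n) i hn

lemma exists_lim {U : Ultrafilter ℕ} (hU : (U : Filter ℕ) ≤ cofinite) {w : ℕ → ℕ → ℕ}
    {z : ℕ → ℕ} (h : ∀ n, ∀ i < n, w n i ≤ z i) : ∃ v, Tendsto w U (𝓝 v) := by
  have : ∀ i, ∃ c, ∀ᶠ n in U, w n i = c := by
    intro i
    have h1 : ∀ᶠ n in U, w n i ∈ Set.Iic (z i) := by
      have : ∀ᶠ n in cofinite, i < n := by
        rw [Nat.cofinite_eq_atTop]; exact eventually_gt_atTop i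
      filter_upwards [hU this] with n hn
      exact h n i hn
    have h2 : ∀ᶠ n in U, ∃ c ∈ Set.Iic (z i), w n i = c := by
      filter_upwards [h1] with n hn using ⟨_, hn, rfl⟩
    obtain ⟨c, _, hc⟩ := (Ultrafilter.eventually_exists_mem_iff (Set.finite_Iic (z i))).1 h2
    exact ⟨c, hc⟩
  choose v hv using this
  refine ⟨v, tendsto_pi_nhds.2 fun i => ?_⟩
  exact tendsto_nhds_of_eventually_eq (hv i)

lemma compactness {F : (ℕ → ℕ) → (ℕ → Bool) × (ℕ → Bool)} (hF : Continuous F)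
    (htr : ∀ {x y z}, (x, y) ∈ Set.range F → (y, z) ∈ Set.range F → (x, z) ∈ Set.range F)
    {y : ℕ → Bool} (hy : (y, y) ∈ Set.range F) {z : ℕ → ℕ}
    {U : Ultrafilter ℕ} (hU : (U : Filter ℕ) ≤ cofinite) (k : ℕ) :
    ∀ (a : ℕ → ℕ → Bool) (x : ℕ → Bool), Tendsto a U (𝓝 x) →
      (∀ n, Ch (Gr F (pre z n)) k (pre (a n) n) (pre y n)) → (x, y) ∈ Set.range F := by
  induction k with
  | zero =>
    intro a x ha h
    have h1 := tendsto_of_agree (b := fun _ => y) hU (fun n => h n) ha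
    have : x = y := tendsto_nhds_unique h1 tendsto_const_nhds
    exact this ▸ hy
  | succ k ih =>
    intro a x ha h
    have h' : ∀ n, ∃ w : ℕ → ℕ, pre (a n) n = pre (F w).1 n ∧ (∀ i < n, w i ≤ z i) ∧
        Ch (Gr F (pre z n)) k (pre (F w).2 n) (pre y n) := by
      intro n
      obtain ⟨u, ⟨w, h1, h2, h3⟩, h4⟩ := h n
      rw [pre_length] at h1 h2 h3
      exact ⟨w, h1.symm, pre_le h3, h2 ▸ h4⟩
    choose w h1 h2 h3 using h'
    obtain ⟨v, hv⟩ := exists_lim hU h2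
    have hFv : Tendsto (fun n => F (w n)) U (𝓝 (F v)) := (hF.tendsto v).comp hv
    have e1 : Tendsto (fun n => (F (w n)).1) U (𝓝 (F v).1) :=
      (continuous_fst.tendsto _).comp hFv
    have e2 : Tendsto (fun n => (F (w n)).2) U (𝓝 (F v).2) :=
      (continuous_snd.tendsto _).comp hFv
    have hx : x = (F v).1 := tendsto_nhds_unique (tendsto_of_agree hU h1 ha) e1
    exact htr (y := (F v).2) ⟨v, by rw [hx]⟩ (ih _ _ e2 h3)

end GpE

namespace GpE

open MeasureTheory Filter Topology

/-! ### The abelian groups -/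

/-- The indexed primes. -/
noncomputable def pr (i : List Bool ⊕ ℕ) : ℕ := Nat.nth Nat.Prime (Encodable.encode i)

lemma pr_prime (i : List Bool ⊕ ℕ) : (pr i).Prime := Nat.prime_nth_prime _

lemma pr_injective : Function.Injective pr := fun _ _ h =>
  Encodable.encode_injective (Nat.nth_injective Nat.infinite_setOfPred_prime h)

/-- The ambient rational vector space. -/
abbrev V := Node →₀ ℚ

/-- Generators. -/
def Gens (E : List Bool → Node → Prop) : Set V :=
  {g | (∃ t, g = Finsupp.single t 1) ∨
    (∃ u t, ∃ j : ℕ, E u t ∧ g = Finsupp.single t (1 / (pr (.inl u) : ℚ) ^ j)) ∨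
    (∃ (k : ℕ) (s : List ℕ) (i j : ℕ),
      g = Finsupp.single (k, i :: s) (1 / (pr (.inr s.length) : ℚ) ^ j) -
        Finsupp.single (k, s) (1 / (pr (.inr s.length) : ℚ) ^ j))}

/-- The group attached to a labelling. -/
noncomputable def Ab (E : List Bool → Node → Prop) : AddSubgroup V := AddSubgroup.closure (Gens E)

lemma local_zero {E : List Bool → Node → Prop} {p : ℕ} (hp : p.Prime) (L : V →+ ℚ)
    (hL : ∀ g ∈ Gens E, padicNorm p (L g) ≤ 1) {v : V}
    (hv : ∀ n : ℕ, ∃ w ∈ Ab E, p ^ n • w = v) : L v = 0 := by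
  have : Fact p.Prime := ⟨hp⟩
  have hA : ∀ w ∈ Ab E, padicNorm p (L w) ≤ 1 := by
    intro w hw
    induction hw using AddSubgroup.closure_induction with
    | mem x hx => exact hL x hx
    | zero => simp
    | add x y _ _ hx hy =>
      rw [map_add]
      exact padicNorm.nonarchimedean.trans (max_le hx hy)
    | neg x _ hx => rwa [map_neg, padicNorm.neg]
  by_contra hne
  have hpos : 0 < padicNorm p (L v) :=
    lt_of_le_of_ne (padicNorm.nonneg _) (padicNorm.nonzero hne).symm
  obtain ⟨n, hn⟩ := exists_pow_lt_of_lt_one hpos (padicNorm.padicNorm_p_lt_one_of_prime (p := p))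
  obtain ⟨w, hw, rfl⟩ := hv n
  rw [map_nsmul, nsmul_eq_mul, padicNorm.mul] at hn
  have : padicNorm p ((p ^ n : ℕ) : ℚ) = padicNorm p p ^ n := by
    push_cast
    exact map_pow (IsAbsoluteValue.toAbsoluteValue (padicNorm p)) (p : ℚ) n
  rw [this] at hn
  have h2 := mul_le_of_le_one_right (pow_nonneg (padicNorm.nonneg (p := p) (p : ℚ)) n) (hA w hw)
  exact absurd hn (not_lt.2 h2)

lemma norm_inv_pow {p q : ℕ} (hp : p.Prime) (hq : q.Prime) (h : p ≠ q) (j : ℕ) :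
    padicNorm p (1 / (q : ℚ) ^ j) ≤ 1 := by
  have : Fact p.Prime := ⟨hp⟩
  have : Fact q.Prime := ⟨hq⟩
  have e : padicNorm p ((q : ℚ) ^ j) = padicNorm p q ^ j :=
    map_pow (IsAbsoluteValue.toAbsoluteValue (padicNorm p)) (q : ℚ) j
  rw [padicNorm.div, e, padicNorm.padicNorm_of_prime_of_ne h]
  simp

/-- `v` is infinitely `p`-divisible in the group. -/
def Dv (E : List Bool → Node → Prop) (p : ℕ) (v : V) : Prop :=
  ∀ n : ℕ, ∃ w ∈ Ab E, p ^ n • w = v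

lemma norm_ite {p : ℕ} [Fact p.Prime] (c : Prop) [Decidable c] {r : ℚ} (h : padicNorm p r ≤ 1) :
    padicNorm p (if c then r else 0) ≤ 1 := by
  split_ifs
  · exact h
  · simp

lemma coord_zero {E : List Bool → Node → Prop} {u : List Bool} {v : V}
    (hv : Dv E (pr (.inl u)) v) {t : Node} (ht : ¬ E u t) : v t = 0 := by
  have : Fact (pr (.inl u)).Prime := ⟨pr_prime _⟩
  refine local_zero (pr_prime (.inl u)) (Finsupp.applyAddHom t) ?_ hv
  rintro g (⟨t', rfl⟩ | ⟨u', t', j, hE, rfl⟩ | ⟨k, s, i, j, rfl⟩)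
  · simp only [Finsupp.applyAddHom_apply, Finsupp.single_apply]
    exact norm_ite _ (by simp)
  · simp only [Finsupp.applyAddHom_apply, Finsupp.single_apply]
    split_ifs with h
    · subst h
      refine norm_inv_pow (pr_prime _) (pr_prime _) (fun h => ht ?_) _
      have := pr_injective h
      simp only [Sum.inl.injEq] at this
      exact this ▸ hE
    · simp
  · have := norm_inv_pow (pr_prime (.inl u)) (pr_prime (.inr s.length))
      (fun h => by simpa using pr_injective h) j
    simp only [Finsupp.applyAddHom_apply, Finsupp.sub_apply, Finsupp.single_apply]
    exact padicNorm.sub.trans (max_le (norm_ite _ this) (norm_ite _ this))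

/-- The functional `v ↦ v t + ∑ᵢ v (i :: t)`. -/
noncomputable def fnl (t : Node) : V →+ ℚ :=
  Finsupp.liftAddHom fun t' : Node =>
    if t' = t ∨ (t'.1 = t.1 ∧ t'.2.tail = t.2 ∧ t'.2 ≠ []) then AddMonoidHom.id ℚ else 0

lemma fnl_single (t t' : Node) (r : ℚ) : fnl t (Finsupp.single t' r) =
    if t' = t ∨ (t'.1 = t.1 ∧ t'.2.tail = t.2 ∧ t'.2 ≠ []) then r else 0 := by
  simp only [fnl, Finsupp.liftAddHom_apply_single]
  split_ifs <;> simp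

lemma fnl_zero {E : List Bool → Node → Prop} {t : Node} {v : V}
    (hv : Dv E (pr (.inr t.2.length)) v) : fnl t v = 0 := by
  have : Fact (pr (.inr t.2.length)).Prime := ⟨pr_prime _⟩
  refine local_zero (pr_prime (.inr t.2.length)) (fnl t) ?_ hv
  rintro g (⟨t', rfl⟩ | ⟨u', t', j, hE, rfl⟩ | ⟨k, s, i, j, rfl⟩)
  · rw [fnl_single]
    exact norm_ite _ (by simp)
  · rw [fnl_single]
    exact norm_ite _ (norm_inv_pow (pr_prime _) (pr_prime _)
      (fun h => by simpa using pr_injective h) j)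
  · rw [map_sub, fnl_single, fnl_single]
    by_cases hs : s.length = t.2.length
    · have : (((k, i :: s) : Node) = t ∨
          (((k, i :: s) : Node).1 = t.1 ∧ ((k, i :: s) : Node).2.tail = t.2 ∧
            ((k, i :: s) : Node).2 ≠ [])) ↔
          (((k, s) : Node) = t ∨ (((k, s) : Node).1 = t.1 ∧ ((k, s) : Node).2.tail = t.2 ∧
            ((k, s) : Node).2 ≠ [])) := by
        obtain ⟨k', s'⟩ := t
        simp only [Prod.mk.injEq, List.tail_cons, ne_eq, reduceCtorEq, not_false_eq_true,
          and_true] at hs ⊢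
        constructor
        · rintro (⟨_, rfl⟩ | h)
          · simp at hs
          · exact Or.inl h
        · rintro (h | ⟨h1, rfl, h2⟩)
          · exact Or.inr h
          · cases s with
            | nil => exact absurd rfl h2
            | cons a s => simp at hs
      simp only [this, sub_self, padicNorm.zero]
      exact zero_le_one
    · have := norm_inv_pow (pr_prime (.inr t.2.length)) (pr_prime (.inr s.length))
        (fun h => hs (by simpa using (pr_injective h).symm)) j
      exact padicNorm.sub.trans (max_le (norm_ite _ this) (norm_ite _ this))

lemma fnl_eq (t : Node) (v : V) (hv : ∀ t' ∈ v.support, t'.2.length = t.2.length) :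
    fnl t v = v t := by
  rw [fnl, Finsupp.liftAddHom_apply, Finsupp.sum, Finset.sum_eq_single t]
  · simp
  · intro t' ht' hne
    rw [if_neg]
    · rfl
    · rintro (h | ⟨_, h2, h3⟩)
      · exact hne h
      · have h4 := hv t' ht'
        rw [← h2, List.length_tail] at h4
        have := List.length_pos_iff.2 h3
        omega
  · intro h
    simp [Finsupp.notMem_support_iff.1 h]

lemma fnl_ne (t : Node) (v : V) (hv : ∀ t' ∈ v.support, t'.2.length = t.2.length + 1)
    (h : fnl t v ≠ 0) : ∃ i, v (t.1, i :: t.2) ≠ 0 := by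
  rw [fnl, Finsupp.liftAddHom_apply, Finsupp.sum] at h
  obtain ⟨⟨k, s⟩, hs, hne⟩ := Finset.exists_ne_zero_of_sum_ne_zero h
  split_ifs at hne with hc
  · rcases hc with rfl | ⟨h1, h2, h3⟩
    · have := hv _ hs
      omega
    · cases s with
      | nil => exact absurd rfl h3
      | cons i s =>
        simp only [List.tail_cons] at h1 h2
        subst h1 h2
        exact ⟨i, hne⟩
  · simp at hne

lemma single_mem (E : List Bool → Node → Prop) (t : Node) : Finsupp.single t 1 ∈ Ab E :=
  AddSubgroup.subset_closure (Or.inl ⟨t, rfl⟩)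

lemma nsmul_inv_pow {q : ℕ} (hq : q.Prime) (t : Node) (j : ℕ) :
    q ^ j • (Finsupp.single t (1 / (q : ℚ) ^ j) : V) = Finsupp.single t 1 := by
  have : (q : ℚ) ≠ 0 := by exact_mod_cast hq.ne_zero
  rw [Finsupp.smul_single]
  congr 1
  rw [nsmul_eq_mul]
  push_cast
  field_simp

/-- The basic element at a node. -/
noncomputable def be (E : List Bool → Node → Prop) (t : Node) : Ab E :=
  ⟨Finsupp.single t 1, single_mem E t⟩

lemma dv_map {E E' : List Bool → Node → Prop} (φ : Ab E →+ Ab E') {p : ℕ} {v : Ab E}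
    (h : Dv E p v) : Dv E' p (φ v) := by
  intro n
  obtain ⟨w, hw, he⟩ := h n
  refine ⟨φ ⟨w, hw⟩, (φ ⟨w, hw⟩).2, ?_⟩
  have : v = p ^ n • ⟨w, hw⟩ := Subtype.ext he.symm
  rw [this, map_nsmul]
  rfl

lemma dv_lab {E : List Bool → Node → Prop} {u : List Bool} {t : Node} (h : E u t) :
    Dv E (pr (.inl u)) (be E t) := fun n =>
  ⟨_, AddSubgroup.subset_closure (Or.inr (Or.inl ⟨u, t, n, h, rfl⟩)), nsmul_inv_pow (pr_prime _) _ _⟩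

lemma dv_edge (E : List Bool → Node → Prop) (k i : ℕ) (s : List ℕ) :
    Dv E (pr (.inr s.length)) ((be E (k, i :: s) - be E (k, s) : Ab E) : V) := by
  intro n
  refine ⟨_, AddSubgroup.subset_closure (Or.inr (Or.inr ⟨k, s, i, n, rfl⟩)), ?_⟩
  rw [smul_sub, nsmul_inv_pow (pr_prime _), nsmul_inv_pow (pr_prime _)]
  rfl

lemma exists_branch {E E' : List Bool → Node → Prop} (hE' : ∀ u t, E' u t → u.length = t.2.length)
    {x : ℕ → Bool} (hE : ∀ n, E (pre x n) (0, pre (fun _ => 0) n))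
    (φ : Ab E →+ Ab E') (hφ : Function.Injective φ) :
    ∃ k z, ∀ n, E' (pre x n) (k, pre z n) := by
  let v : ℕ → V := fun n => φ (be E (0, pre (fun _ => 0) n))
  have hsupp : ∀ n t, v n t ≠ 0 → E' (pre x n) t := by
    intro n t ht
    by_contra hne
    exact ht (coord_zero (dv_map φ (dv_lab (hE n))) hne)
  have hlen : ∀ n t, t ∈ (v n).support → t.2.length = n := by
    intro n t ht
    have := hE' _ _ (hsupp n t (Finsupp.mem_support_iff.1 ht))
    simpa using this.symm
  have hstep : ∀ n (t : Node), v n t ≠ 0 → ∃ i, v (n + 1) (t.1, i :: t.2) ≠ 0 := by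
    intro n t ht
    have hl := hlen n t (Finsupp.mem_support_iff.2 ht)
    have h1 : Dv E' (pr (.inr t.2.length)) (v (n + 1) - v n) := by
      have := dv_map φ (dv_edge E 0 0 (pre (fun _ => 0) n))
      rw [map_sub, pre_length] at this
      rw [hl]
      exact this
    have h2 := fnl_zero h1
    rw [map_sub, fnl_eq t (v n) (fun t' h => by rw [hlen n t' h, hl]), sub_eq_zero] at h2
    exact fnl_ne t (v (n + 1)) (fun t' h => by rw [hlen _ t' h, hl]) (h2 ▸ ht)
  have h0 : v 0 ≠ 0 := by
    intro h
    have h1 : φ (be E (0, [])) = 0 := Subtype.ext h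
    have h2 : be E (0, []) = 0 := hφ (h1.trans (map_zero φ).symm)
    have h3 : (Finsupp.single ((0, []) : Node) (1 : ℚ)) = 0 := congrArg Subtype.val h2
    simp at h3
  obtain ⟨⟨k, s⟩, hks⟩ := Finsupp.support_nonempty_iff.2 h0
  have hs : s = [] := List.length_eq_zero_iff.1 (hlen 0 _ hks)
  subst hs
  choose! f hf using hstep
  let b : ℕ → List ℕ := fun n => Nat.rec [] (fun n s => f n (k, s) :: s) n
  refine ⟨k, fun n => f n (k, b n), ?_⟩
  have hb : ∀ n, pre (fun n => f n (k, b n)) n = b n := by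
    intro n
    induction n with
    | zero => rfl
    | succ n ih => rw [pre, ih]
  have hv : ∀ n, v n (k, b n) ≠ 0 := by
    intro n
    induction n with
    | zero => exact Finsupp.mem_support_iff.1 hks
    | succ n ih => exact hf n (k, b n) ih
  intro n
  rw [hb]
  exact hsupp n _ (hv n)

lemma exists_hom {F : (ℕ → ℕ) → (ℕ → Bool) × (ℕ → Bool)} {x y : ℕ → Bool}
    (h : (x, y) ∈ Set.range F) :
    ∃ φ : Ab (Lab F x) →+ Ab (Lab F y), Function.Injective φ := by
  obtain ⟨w, hw⟩ := h
  let sh : Node → Node := fun t => (t.1 + 1, shift w t.2)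
  have hsh : Function.Injective sh := by
    rintro ⟨k, s⟩ ⟨k', s'⟩ h
    simp only [sh, Prod.mk.injEq, add_left_inj] at h
    rw [h.1, shift_injective w h.2]
  let Φ : V →+ V := Finsupp.mapDomain.addMonoidHom sh
  have hΦ : Function.Injective Φ := Finsupp.mapDomain_injective hsh
  have hs : ∀ t r, Φ (Finsupp.single t r) = Finsupp.single (sh t) r := fun t r =>
    Finsupp.mapDomain_single
  have hmap : ∀ v ∈ Ab (Lab F x), Φ v ∈ Ab (Lab F y) := by
    have : Ab (Lab F x) ≤ (Ab (Lab F y)).comap Φ := by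
      rw [Ab, AddSubgroup.closure_le]
      rintro g (⟨t', rfl⟩ | ⟨u', t', j, hE, rfl⟩ | ⟨k, s, i, j, rfl⟩)
      · exact AddSubgroup.subset_closure (Or.inl ⟨sh t', hs _ _⟩)
      · exact AddSubgroup.subset_closure (Or.inr (Or.inl ⟨u', sh t', j, lab_shift hw hE, hs _ _⟩))
      · refine AddSubgroup.subset_closure (Or.inr (Or.inr ⟨k + 1, shift w s, i + w s.length, j, ?_⟩))
        rw [map_sub, hs, hs, shift_length]
        rfl
    exact this
  refine ⟨(Φ.comp (Ab (Lab F x)).subtype).codRestrict _ fun v => hmap v v.2, ?_⟩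
  intro a b h
  exact Subtype.ext (hΦ (congrArg Subtype.val h))

/-! ### Transfer to `ℕ` -/

noncomputable def toNat : V ≃ ℕ :=
  Classical.choice (nonempty_equiv_of_countable (α := V) (β := ℕ))

/-- Codes of members of a subgroup. -/
def mem' (A : AddSubgroup V) (n : ℕ) : Prop := toNat.symm n ∈ A

lemma infinite_mem (A : AddSubgroup V) (h : ∀ t, Finsupp.single t 1 ∈ A) :
    (Set.ofPred (mem' A)).Infinite := by
  refine Set.infinite_of_injective_forall_mem (f := fun t : Node => toNat (Finsupp.single t 1)) ?_ ?_
  · intro a b h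
    exact Finsupp.single_left_injective one_ne_zero (toNat.injective h)
  · intro t
    change toNat.symm (toNat _) ∈ A
    simpa using h t

/-- Enumeration of a subgroup. -/
noncomputable def enu (A : AddSubgroup V) (i : ℕ) : V := toNat.symm (Nat.nth (mem' A) i)

lemma enu_mem {A : AddSubgroup V} (h : ∀ t, Finsupp.single t 1 ∈ A) (i : ℕ) : enu A i ∈ A :=
  Nat.nth_mem_of_infinite (infinite_mem A h) i

lemma enu_inj {A : AddSubgroup V} (h : ∀ t, Finsupp.single t 1 ∈ A) : Function.Injective (enu A) :=
  toNat.symm.injective.comp (Nat.nth_injective (infinite_mem A h))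

lemma enu_surj {A : AddSubgroup V} (h : ∀ t, Finsupp.single t 1 ∈ A) {v : V} (hv : v ∈ A) :
    ∃ i, enu A i = v := by
  have : toNat v ∈ Set.range (Nat.nth (mem' A)) := by
    rw [Nat.range_nth_of_infinite (infinite_mem A h)]
    simpa [mem'] using hv
  obtain ⟨i, hi⟩ := this
  exact ⟨i, by rw [enu, hi, Equiv.symm_apply_apply]⟩

/-- Enumeration as an equivalence. -/
noncomputable def eqv (A : AddSubgroup V) (h : ∀ t, Finsupp.single t 1 ∈ A) : ℕ ≃ A :=
  Equiv.ofBijective (fun i => ⟨enu A i, enu_mem h i⟩)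
    ⟨fun _ _ e => enu_inj h (congrArg Subtype.val e),
      fun v => (enu_surj h v.2).imp fun _ hi => Subtype.ext hi⟩

/-- The group on `ℕ`. -/
noncomputable def gp (A : AddSubgroup V) (h : ∀ t, Finsupp.single t 1 ∈ A) : XGp :=
  ⟨fun p => (eqv A h).symm (eqv A h p.1 + eqv A h p.2), by
    refine ⟨fun a b c => by simp [add_assoc], (eqv A h).symm 0, fun a => by simp, fun a =>
      ⟨(eqv A h).symm (-(eqv A h a)), by simp⟩⟩⟩

lemma gp_embeds_iff {A B : AddSubgroup V} (hA : ∀ t, Finsupp.single t 1 ∈ A)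
    (hB : ∀ t, Finsupp.single t 1 ∈ B) :
    GpEmbeds (gp A hA) (gp B hB) ↔ ∃ φ : A →+ B, Function.Injective φ := by
  constructor
  · rintro ⟨g, hg, h⟩
    refine ⟨AddMonoidHom.mk' (fun a => eqv B hB (g ((eqv A hA).symm a))) ?_, ?_⟩
    · intro a b
      have := h ((eqv A hA).symm a) ((eqv A hA).symm b)
      simp only [gp, Equiv.apply_symm_apply] at this
      rw [this, Equiv.apply_symm_apply]
    · intro a b hab
      exact (eqv A hA).symm.injective (hg ((eqv B hB).injective hab))
  · rintro ⟨φ, hφ⟩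
    refine ⟨fun i => (eqv B hB).symm (φ (eqv A hA i)), ?_, ?_⟩
    · exact (eqv B hB).symm.injective.comp (hφ.comp (eqv A hA).injective)
    · intro a b
      simp [gp]

lemma gp_apply_iff {A : AddSubgroup V} (h : ∀ t, Finsupp.single t 1 ∈ A) (i j k : ℕ) :
    (gp A h).1 (i, j) = k ↔ enu A i + enu A j = enu A k := by
  simp only [gp, Equiv.symm_apply_eq]
  rw [Subtype.ext_iff]
  rfl

open Classical in
lemma enu_eq_iff {A : AddSubgroup V} (h : ∀ t, Finsupp.single t 1 ∈ A) (i : ℕ) (v : V) :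
    enu A i = v ↔ mem' A (toNat v) ∧ Nat.count (mem' A) (toNat v) = i := by
  rw [enu, Equiv.symm_apply_eq]
  constructor
  · intro e
    rw [← e]
    exact ⟨Nat.nth_mem_of_infinite (infinite_mem A h) i,
      Nat.count_nth_of_infinite (infinite_mem A h) i⟩
  · rintro ⟨h1, rfl⟩
    exact Nat.nth_count h1

lemma measurable_gp {X : Type*} [MeasurableSpace X] (A : X → AddSubgroup V)
    (h : ∀ x t, Finsupp.single t 1 ∈ A x) (hm : ∀ v, MeasurableSet {x | v ∈ A x}) :
    Measurable fun x => gp (A x) (h x) := by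
  classical
  have h1 : ∀ n, Measurable fun x => Nat.count (mem' (A x)) n := by
    intro n
    induction n with
    | zero => simp
    | succ n ih =>
      simp only [Nat.count_succ]
      refine ih.add (Measurable.ite (hm (toNat.symm n)) measurable_const measurable_const)
  have h2 : ∀ i v, MeasurableSet {x | enu (A x) i = v} := by
    intro i v
    have : {x | enu (A x) i = v} = {x | toNat.symm (toNat v) ∈ A x} ∩
        {x | Nat.count (mem' (A x)) (toNat v) = i} := by
      ext x
      exact enu_eq_iff (h x) i v
    rw [this]
    exact (hm _).inter (measurableSet_eq_fun (h1 _) measurable_const)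
  refine Measurable.subtype_mk (measurable_pi_iff.2 ?_)
  rintro ⟨i, j⟩
  refine measurable_to_countable' fun k => ?_
  have : (fun x => (gp (A x) (h x)).1 (i, j)) ⁻¹' {k} =
      ⋃ a : V, ⋃ b : V, {x | enu (A x) i = a} ∩ {x | enu (A x) j = b} ∩
        {x | enu (A x) k = a + b} := by
    ext x
    simp only [Set.mem_preimage, Set.mem_singleton_iff, gp_apply_iff, Set.mem_iUnion,
      Set.mem_inter_iff, Set.mem_ofPred_eq]
    constructor
    · intro e
      exact ⟨_, _, ⟨rfl, rfl⟩, e.symm⟩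
    · rintro ⟨a, b, ⟨rfl, rfl⟩, e⟩
      exact e.symm
  have goal : MeasurableSet ((fun x => (gp (A x) (h x)).1 (i, j)) ⁻¹' {k}) := by
    rw [this]
    exact .iUnion fun a => .iUnion fun b => ((h2 _ _).inter (h2 _ _)).inter (h2 _ _)
  exact goal

/-! ### Measurability of the groups -/

lemma measurable_closure {X : Type*} [MeasurableSpace X] (G : X → Set V)
    (hG : ∀ v, MeasurableSet {x | v ∈ G x}) (v : V) :
    MeasurableSet {x | v ∈ AddSubgroup.closure (G x)} := by
  have : {x | v ∈ AddSubgroup.closure (G x)} =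
      ⋃ S : Finset V, ⋃ (_ : v ∈ AddSubgroup.closure (S : Set V)), ⋂ g ∈ S, {x | g ∈ G x} := by
    ext x
    simp only [Set.mem_ofPred_eq, Set.mem_iUnion, Set.mem_iInter, exists_prop]
    constructor
    · intro hv
      induction hv using AddSubgroup.closure_induction with
      | mem a ha =>
        exact ⟨{a}, AddSubgroup.subset_closure (by simp), by simpa using ha⟩
      | zero => exact ⟨∅, zero_mem _, by simp⟩
      | add a b _ _ ha hb =>
        classical
        obtain ⟨S, h1, h2⟩ := ha
        obtain ⟨S', h1', h2'⟩ := hb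
        refine ⟨S ∪ S', add_mem (AddSubgroup.closure_mono (by simp) h1)
          (AddSubgroup.closure_mono (by simp) h1'), ?_⟩
        intro g hg
        rcases Finset.mem_union.1 hg with h | h
        · exact h2 g h
        · exact h2' g h
      | neg a _ ha =>
        obtain ⟨S, h1, h2⟩ := ha
        exact ⟨S, neg_mem h1, h2⟩
    · rintro ⟨S, h1, h2⟩
      exact AddSubgroup.closure_mono (fun g hg => h2 g hg) h1
  rw [this]
  exact .iUnion fun S => .iUnion fun _ => .biInter S.countable_toSet fun g _ => hG g

lemma measurable_pre {X : Type*} [MeasurableSpace X] {f : X → ℕ → Bool} (hf : Measurable f)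
    (n : ℕ) (l : List Bool) : MeasurableSet {x | pre (f x) n = l} := by
  induction n generalizing l with
  | zero => simp only [pre]; exact MeasurableSet.const _
  | succ n ih =>
    cases l with
    | nil => simp [pre]
    | cons a l =>
      simp only [pre, List.cons.injEq]
      exact (measurableSet_eq_fun ((measurable_pi_apply n).comp hf) measurable_const).inter (ih l)

lemma measurable_lab {X : Type*} [MeasurableSpace X] {f : X → ℕ → Bool} (hf : Measurable f)
    (F : (ℕ → ℕ) → (ℕ → Bool) × (ℕ → Bool)) (u : List Bool) (t : Node) :
    MeasurableSet {x | Lab F (f x) u t} := by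
  have : {x | Lab F (f x) u t} = ⋃ l : List Bool,
      ⋃ (_ : u.length = t.2.length ∧ Ch (Gr F t.2) t.1 u l), {x | pre (f x) t.2.length = l} := by
    ext x
    simp [Lab]
  rw [this]
  exact .iUnion fun l => .iUnion fun _ => measurable_pre hf _ _

lemma measurable_gens {X : Type*} [MeasurableSpace X] {E : X → List Bool → Node → Prop}
    (hE : ∀ u t, MeasurableSet {x | E x u t}) (v : V) : MeasurableSet {x | v ∈ Gens (E x)} := by
  simp only [Gens, Set.mem_ofPred_eq]
  refine (MeasurableSet.const _).union (MeasurableSet.union ?_ (MeasurableSet.const _))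
  have : {x | ∃ u t, ∃ j : ℕ, E x u t ∧ v = Finsupp.single t (1 / (pr (.inl u) : ℚ) ^ j)} =
      ⋃ u, ⋃ t, ⋃ j : ℕ, {x | E x u t} ∩
        {_x | v = Finsupp.single t (1 / (pr (.inl u) : ℚ) ^ j)} := by
    ext x
    simp
  have goal : MeasurableSet
      {x | ∃ u t, ∃ j : ℕ, E x u t ∧ v = Finsupp.single t (1 / (pr (.inl u) : ℚ) ^ j)} := by
    rw [this]
    exact .iUnion fun u => .iUnion fun t => .iUnion fun j => (hE u t).inter (MeasurableSet.const _)
  exact goal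

/-! ### Completeness -/

lemma complete (X : Type*) [MeasurableSpace X] [StandardBorelSpace X] (R : X → X → Prop)
    (hR : IsQuasiOrder R) (hA : IsAnalyticRel R) : BorelReducible R GpEmbeds := by
  by_cases hX : Nonempty X
  swap
  · have : IsEmpty X := not_nonempty_iff.1 hX
    exact ⟨fun x => isEmptyElim x, measurable_of_empty _, fun x => isEmptyElim x⟩
  obtain ⟨f, hf, hinj⟩ := MeasurableSpace.measurable_injection_nat_bool_of_countablySeparated X
  have key : ∃ F : (ℕ → ℕ) → (ℕ → Bool) × (ℕ → Bool), Continuous F ∧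
      ∀ q, q ∈ Set.range F ↔ ∃ x y, R x y ∧ q = (f x, f y) := by
    rcases hA with h | ⟨g, hg, hr⟩
    · exfalso
      obtain ⟨x⟩ := hX
      have hx : (x, x) ∈ {p : X × X | R p.1 p.2} := hR.1 x
      rw [h] at hx
      exact hx
    · let G : (ℕ → ℕ) → (ℕ → Bool) × (ℕ → Bool) := fun w => (f (g w).1, f (g w).2)
      have hG : Measurable G := (hf.comp (measurable_fst.comp hg)).prodMk
        (hf.comp (measurable_snd.comp hg))
      have hAn : AnalyticSet (G '' Set.univ) := MeasurableSet.univ.analyticSet_image hG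
      rw [Set.image_univ, AnalyticSet] at hAn
      rcases hAn with h | ⟨F, hFc, hF⟩
      · exact absurd h (Set.range_nonempty G).ne_empty
      · refine ⟨F, hFc, fun q => ?_⟩
        rw [hF]
        constructor
        · rintro ⟨w, rfl⟩
          have hw : g w ∈ {p : X × X | R p.1 p.2} := hr ▸ Set.mem_range_self w
          exact ⟨_, _, hw, rfl⟩
        · rintro ⟨x, y, hxy, rfl⟩
          have hw : (x, y) ∈ Set.range g := by rw [hr]; exact hxy
          obtain ⟨w, hw⟩ := hw
          exact ⟨w, by simp [G, hw]⟩
  obtain ⟨F, hFc, hF⟩ := key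
  have hQ : ∀ x y, R x y ↔ (f x, f y) ∈ Set.range F := by
    intro x y
    rw [hF]
    constructor
    · intro h
      exact ⟨x, y, h, rfl⟩
    · rintro ⟨x', y', h, e⟩
      obtain ⟨e1, e2⟩ := Prod.mk.inj e
      rwa [hinj e1, hinj e2]
  have htr : ∀ {x y z}, (x, y) ∈ Set.range F → (y, z) ∈ Set.range F → (x, z) ∈ Set.range F := by
    intro x y z h1 h2
    rw [hF] at h1 h2 ⊢
    obtain ⟨a, b, h, e⟩ := h1
    obtain ⟨b', c, h', e'⟩ := h2
    obtain ⟨rfl, rfl⟩ := Prod.mk.inj e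
    obtain ⟨e1, rfl⟩ := Prod.mk.inj e'
    obtain rfl := hinj e1
    exact ⟨a, c, hR.2 h h', rfl⟩
  refine ⟨fun x => gp (Ab (Lab F (f x))) (single_mem _),
    measurable_gp _ _ (measurable_closure _ (measurable_gens (measurable_lab hf F))), ?_⟩
  intro x y
  rw [gp_embeds_iff, hQ]
  constructor
  · exact exists_hom
  · rintro ⟨φ, hφ⟩
    obtain ⟨k, z, h⟩ := exists_branch (fun u t h => h.1) (lab_zero F (f x)) φ hφ
    refine compactness hFc htr ((hQ y y).1 (hR.1 y)) (z := z) (U := hyperfilter ℕ)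
      (hyperfilter_le_cofinite) k (fun _ => f x) (f x) tendsto_const_nhds fun n => ?_
    have := (h n).2
    simpa using this

end GpE
/-- **Completeness of embeddability between countable groups.**
`⊑_Gp` is an analytic quasi-order on `X_Gp`, and every analytic quasi-order `R` on a
standard Borel space `X` is Borel reducible to it. -/
theorem gpEmbeds_complete_analytic_quasiOrder :
    IsQuasiOrder GpEmbeds ∧ IsAnalyticRel GpEmbeds ∧
      ∀ (X : Type*) [MeasurableSpace X] [StandardBorelSpace X] (R : X → X → Prop),
        IsQuasiOrder R → IsAnalyticRel R → BorelReducible R GpEmbeds :=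
  ⟨GpE.isQuasiOrder_gpEmbeds, GpE.isAnalyticRel_gpEmbeds, GpE.complete⟩
end

section
/- The embeddability relation ⊑_Gr on X_Gr is a complete analytic quasi-order: ⊑_Gr is an analytic quasi-order on X_Gr, and every analytic quasi-order R on a standard Borel space X satisfies R ≤_B ⊑_Gr. -/
/-- The Polish space of simple graphs on `ℕ`, coded as symmetric irreflexive
`{0,1}`-valued functions on `ℕ × ℕ`. -/
abbrev XGr := { A : ℕ × ℕ → Bool // (∀ a b, A (a, b) = A (b, a)) ∧ ∀ a, A (a, a) = false }

/-- Embeddability of countable graphs. -/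
def GrEmbeds (T S : XGr) : Prop :=
  ∃ f : ℕ → ℕ, Function.Injective f ∧
    ∀ m n, T.1 (m, n) = true ↔ S.1 (f m, f n) = true

namespace LR

/-- Vertices of the coding graphs: constants, nodes, gadgets, spares. -/
inductive Vtx where
  | c (n : ℕ) : Vtx
  | nd (s : List ℕ) : Vtx
  | gd (u : List Bool) (s : List ℕ) : Vtx
  | sp (n : ℕ) : Vtx

/-- The adjacency relation of the coding graph. -/
def Edge (Act : List Bool → List ℕ → Prop) : Vtx → Vtx → Prop
  | .c i, .c j => i + 2 ≤ j ∨ j + 2 ≤ i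
  | .c i, .nd s => i = 0 ∨ i = 2 * s.length + 1
  | .nd s, .c i => i = 0 ∨ i = 2 * s.length + 1
  | .c i, .gd u s => Act u s ∧ (i = 0 ∨ i = 2 * Encodable.encode u + 2)
  | .gd u s, .c i => Act u s ∧ (i = 0 ∨ i = 2 * Encodable.encode u + 2)
  | .nd s, .nd t => (∃ a, s = a :: t) ∨ (∃ a, t = a :: s)
  | .nd s, .gd u t => Act u t ∧ s = t
  | .gd u t, .nd s => Act u t ∧ s = t
  | _, _ => False

theorem Edge.symm {Act} : ∀ v w, Edge Act v w → Edge Act w v := by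
  intro v w
  cases v <;> cases w <;> simp only [Edge] <;> tauto

theorem Edge.irrefl {Act} : ∀ v, ¬ Edge Act v v := by
  intro v
  cases v <;> simp [Edge]

/-- Translation of (reversed) sequences. -/
def shift (γ : ℕ → ℕ) : List ℕ → List ℕ
  | [] => []
  | a :: s => (a + γ s.length) :: shift γ s

@[simp] theorem shift_length (γ) (s : List ℕ) : (shift γ s).length = s.length := by
  induction s with
  | nil => rfl
  | cons a s ih => simp [shift, ih]

theorem shift_inj (γ) : ∀ s t : List ℕ, shift γ s = shift γ t ↔ s = t := by
  intro s
  induction s with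
  | nil => intro t; cases t <;> simp [shift]
  | cons a s ih =>
    intro t
    cases t with
    | nil => simp [shift]
    | cons b t =>
      simp only [shift, List.cons.injEq, ih]
      constructor
      · rintro ⟨h, rfl⟩; exact ⟨by omega, rfl⟩
      · rintro ⟨rfl, rfl⟩; exact ⟨rfl, rfl⟩

theorem shift_cons (γ) (s t : List ℕ) :
    (∃ a, shift γ s = a :: shift γ t) ↔ ∃ a, s = a :: t := by
  constructor
  · rintro ⟨a, h⟩
    cases s with
    | nil => simp [shift] at h
    | cons b s =>
      simp only [shift, List.cons.injEq, shift_inj] at h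
      exact ⟨b, by rw [h.2]⟩
  · rintro ⟨a, rfl⟩; exact ⟨_, rfl⟩

/-- The function coded by a (reversed) sequence. -/
def val : List ℕ → ℕ → ℕ
  | [] => fun _ => 0
  | a :: s => fun i => if i = s.length then a else val s i

theorem val_shift (γ) (s : List ℕ) : ∀ i < s.length, val (shift γ s) i = val s i + γ i := by
  induction s with
  | nil => simp
  | cons a s ih =>
    intro i hi
    simp only [shift, val, shift_length]
    split_ifs with h
    · rw [h]
    · exact ih i (by simp at hi; omega)

theorem val_replicate (n i : ℕ) : val (List.replicate n 0) i = 0 := by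
  induction n with
  | zero => rfl
  | succ n ih => simp [List.replicate_succ, val, ih]

open Classical in
/-- The map of vertices induced by a translation. -/
noncomputable def fwd (A : List Bool → List ℕ → Prop) (γ : ℕ → ℕ) : Vtx → Vtx
  | .c i => .c i
  | .nd s => .nd (shift γ s)
  | .gd u s => if A u s then .gd u (shift γ s) else .sp (2 * Encodable.encode (u, s) + 1)
  | .sp n => .sp (2 * n)

theorem fwd_inj (A γ) : Function.Injective (fwd A γ) := by
  intro v w h
  cases v <;> cases w <;> simp only [fwd] at h <;> (try split_ifs at h) <;>
    simp_all [shift_inj] <;> omega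

theorem fwd_edge (A B : List Bool → List ℕ → Prop) (γ)
    (hAB : ∀ u s, A u s → B u (shift γ s)) (v w : Vtx) :
    Edge A v w ↔ Edge B (fwd A γ v) (fwd A γ w) := by
  cases v <;> cases w <;> simp only [fwd] <;> (try split_ifs) <;>
    simp_all [Edge, shift_inj, shift_cons]

theorem vtx_odd {A} {u v w : Vtx} (hu : ∀ i, u ≠ .c i) (hv : ∀ i, v ≠ .c i) (hw : ∀ i, w ≠ .c i)
    (h1 : Edge A u v) (h2 : Edge A v w) (h3 : Edge A u w) : False := by
  cases u <;> cases v <;> cases w <;> simp_all [Edge]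
  all_goals
    rcases h1 with ⟨a, rfl⟩ | ⟨a, rfl⟩ <;> (try rcases h2 with ⟨b, h2⟩ | ⟨b, h2⟩) <;>
    (try rcases h3 with ⟨d, h3⟩ | ⟨d, h3⟩) <;>
    (try have h2 := congrArg List.length h2) <;> (try have h3 := congrArg List.length h3) <;>
    simp at * <;> omega

theorem label_finite {A} {v : Vtx} (hv : ∀ i, v ≠ .c i) : {i | Edge A v (.c i)}.Finite := by
  cases v with
  | c n => exact absurd rfl (hv n)
  | nd s => exact (Set.toFinite {0, 2 * s.length + 1}).subset (fun i hi => by simpa [Edge] using hi)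
  | gd u s =>
    exact (Set.toFinite {0, 2 * Encodable.encode u + 2}).subset
      (fun i hi => by simpa [Edge] using And.right hi)
  | sp n => exact Set.finite_empty.subset (fun i hi => by simp [Edge] at hi)

theorem const_to_const {A B} (F : Vtx → Vtx) (hF : Function.Injective F)
    (hE : ∀ v w, Edge A v w ↔ Edge B (F v) (F w)) (n : ℕ) : ∃ i, F (.c n) = .c i := by
  by_contra hcon
  push Not at hcon
  have hfin : {m : ℕ | n + 2 ≤ m ∧ ∃ i, F (.c m) = .c i}.Finite := by
    have h1 := ((label_finite (A := B) hcon).image Vtx.c).preimage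
      ((hF.comp (fun a b h => by simpa using h : Function.Injective Vtx.c)).injOn)
    refine h1.subset ?_
    rintro m ⟨hm, i, hi⟩
    refine ⟨i, ?_, by simp [hi]⟩
    have := (hE (.c n) (.c m)).1 (Or.inl hm)
    rwa [hi] at this
  obtain ⟨N, hN⟩ := hfin.bddAbove
  have key : ∀ m, n + 2 + N < m → ∀ i, F (.c m) ≠ .c i := by
    intro m hm i hi
    have := hN ⟨by omega, i, hi⟩
    omega
  refine vtx_odd (A := B) hcon (key (n + 3 + N) (by omega)) (key (n + 5 + N) (by omega))
    ((hE _ _).1 ?_) ((hE _ _).1 ?_) ((hE _ _).1 ?_) <;> simp only [Edge] <;> omega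

theorem const_shift {A B} (F : Vtx → Vtx) (hF : Function.Injective F)
    (hE : ∀ v w, Edge A v w ↔ Edge B (F v) (F w)) : ∃ k, ∀ n, F (.c n) = .c (n + k) := by
  choose π hπ using const_to_const F hF hE
  have hinj : Function.Injective π := by
    intro a b h
    have : F (.c a) = F (.c b) := by rw [hπ, hπ, h]
    simpa using hF this
  have hs : ∀ n, π (n + 1) = π n + 1 ∨ π (n + 1) + 1 = π n := by
    intro n
    have h1 := hE (.c n) (.c (n + 1))
    have h2 : π n ≠ π (n + 1) := fun h => by have := hinj h; omega
    simp only [hπ, Edge] at h1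
    omega
  have hs2 : ∀ n, π (n + 1) ≠ π n + 1 → ∀ j, π (n + j) + j = π n ∧ π (n + j + 1) + j + 1 = π n := by
    intro n hn j
    induction j with
    | zero => have := hs n; simp only [Nat.add_zero, true_and]; omega
    | succ j ih =>
      have h1 := hs (n + j + 1)
      have h2 : π (n + j) ≠ π (n + j + 1 + 1) := fun h => by have := hinj h; omega
      rw [show n + (j + 1) = n + j + 1 by omega]
      omega
  have hs3 : ∀ n, π (n + 1) = π n + 1 := by
    intro n
    by_contra h
    have := hs2 n h (π n + 1)
    omega
  refine ⟨π 0, fun n => ?_⟩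
  rw [hπ]
  congr 1
  induction n with
  | zero => simp
  | succ n ih => rw [hs3, ih]; omega

theorem const_fix {A B} (F : Vtx → Vtx) (hF : Function.Injective F)
    (hE : ∀ v w, Edge A v w ↔ Edge B (F v) (F w)) (n : ℕ) : F (.c n) = .c n := by
  obtain ⟨k, hk⟩ := const_shift F hF hE
  suffices k = 0 by rw [hk, this, Nat.add_zero]
  have h0 := hE (.c 0) (.nd [])
  have h1 := hE (.c 1) (.nd [])
  have hb := fun i => hE (.c (i + 2)) (.nd [])
  simp only [hk] at h0 h1 hb
  cases h : F (.nd []) with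
  | c j =>
    have := hb (j + 2)
    simp [h, Edge] at this
    omega
  | nd s => simp [h, Edge] at h0 h1; omega
  | gd u s => simp [h, Edge] at h0 h1; omega
  | sp m => simp [h, Edge] at h0

theorem node_to_node {A B} (F : Vtx → Vtx) (hF : Function.Injective F)
    (hE : ∀ v w, Edge A v w ↔ Edge B (F v) (F w)) (s : List ℕ) :
    ∃ t : List ℕ, F (.nd s) = .nd t ∧ t.length = s.length := by
  have h := fun i => hE (.c i) (.nd s)
  simp only [const_fix F hF hE] at h
  cases hv : F (.nd s) with
  | c j =>
    have := h (j + 2 * s.length + 2)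
    simp [hv, Edge] at this
    omega
  | nd t =>
    have := h (2 * s.length + 1)
    simp [hv, Edge] at this
    exact ⟨t, rfl, this.symm⟩
  | gd u t =>
    have := h (2 * s.length + 1)
    simp [hv, Edge] at this
    omega
  | sp m =>
    have := h 0
    simp [hv, Edge] at this

theorem gadget_to_gadget {A B} (F : Vtx → Vtx) (hF : Function.Injective F)
    (hE : ∀ v w, Edge A v w ↔ Edge B (F v) (F w)) (u : List Bool) (s : List ℕ) (hus : A u s) :
    ∃ t : List ℕ, F (.gd u s) = .gd u t ∧ B u t := by
  have h := fun i => hE (.c i) (.gd u s)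
  simp only [const_fix F hF hE] at h
  cases hv : F (.gd u s) with
  | c j =>
    have := h (j + 2 * Encodable.encode u + 3)
    simp [hv, Edge, hus] at this
    omega
  | nd t =>
    have := h (2 * Encodable.encode u + 2)
    simp [hv, Edge, hus] at this
    omega
  | gd u' t =>
    have := h (2 * Encodable.encode u + 2)
    simp [hv, Edge, hus] at this
    obtain ⟨h1, h2⟩ := this
    subst h2
    exact ⟨t, rfl, h1⟩
  | sp m =>
    have := h 0
    simp [hv, Edge, hus] at this

theorem bwd {A B} (F : Vtx → Vtx) (hF : Function.Injective F)
    (hE : ∀ v w, Edge A v w ↔ Edge B (F v) (F w)) :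
    ∃ γ : ℕ → ℕ, ∀ n, ∃ t : List ℕ, t.length = n ∧ (∀ i < n, val t i = γ i) ∧
      ∀ u, A u (List.replicate n 0) → B u t := by
  choose ψ hψ hlen using node_to_node F hF hE
  have hcons : ∀ n, ∃ a, ψ (List.replicate (n + 1) 0) = a :: ψ (List.replicate n 0) := by
    intro n
    have h := (hE (.nd (List.replicate (n + 1) 0)) (.nd (List.replicate n 0))).1
      (Or.inl ⟨0, rfl⟩)
    rw [hψ, hψ] at h
    rcases h with h | ⟨a, h⟩
    · exact h
    · have h := congrArg List.length h
      simp [hlen] at h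
      omega
  choose γ hγ using hcons
  refine ⟨γ, fun n => ⟨ψ (List.replicate n 0), by simp [hlen], ?_, ?_⟩⟩
  · induction n with
    | zero => simp
    | succ n ih =>
      intro i hi
      rw [hγ]
      simp only [val, hlen, List.length_replicate]
      split_ifs with h
      · rw [h]
      · exact ih i (by omega)
  · intro u hu
    obtain ⟨t, ht, hB⟩ := gadget_to_gadget F hF hE u _ hu
    have h := (hE (.nd (List.replicate n 0)) (.gd u (List.replicate n 0))).1 ⟨hu, rfl⟩
    rw [ht, hψ] at h
    rw [h.2]
    exact hB

/-- Approximation of the relation `{(p,q) | p = q ∨ (p,q) ∈ range g}` at level `n`. -/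
def Dn (g : (ℕ → ℕ) → (ℕ → Bool) × (ℕ → Bool)) (n : ℕ) (p q : ℕ → Bool) (γ : ℕ → ℕ) : Prop :=
  (∀ i < n, p i = q i) ∨ ∃ β : ℕ → ℕ, (∀ i, i + 1 < n → β i ≤ γ (i + 1)) ∧
    (∀ i < n, (g β).1 i = p i) ∧ (∀ i < n, (g β).2 i = q i)

/-- The normal form tree. -/
def Tn (g : (ℕ → ℕ) → (ℕ → Bool) × (ℕ → Bool)) (n : ℕ) (p q : ℕ → Bool) (γ : ℕ → ℕ) : Prop :=
  ∃ r : ℕ → ℕ → Bool, (∀ i < n, r 0 i = p i) ∧ (∀ i < n, r (γ 0) i = q i) ∧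
    ∀ j < γ 0, Dn g n (r j) (r (j + 1)) γ

theorem Dn.mono {g n p q γ γ'} (h : ∀ i, i + 1 < n → γ (i + 1) ≤ γ' (i + 1)) (hD : Dn g n p q γ) :
    Dn g n p q γ' := by
  rcases hD with hD | ⟨β, h1, h2⟩
  · exact Or.inl hD
  · exact Or.inr ⟨β, fun i hi => (h1 i hi).trans (h i hi), h2⟩

theorem Dn.congr {g n p q p' q' γ} (hp : ∀ i < n, p i = p' i) (hq : ∀ i < n, q i = q' i)
    (hD : Dn g n p q γ) : Dn g n p' q' γ := by
  rcases hD with hD | ⟨β, h1, h2, h3⟩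
  · exact Or.inl fun i hi => by rw [← hp i hi, ← hq i hi, hD i hi]
  · exact Or.inr ⟨β, h1, fun i hi => by rw [h2 i hi, hp i hi], fun i hi => by rw [h3 i hi, hq i hi]⟩

theorem Tn.congr {g n p q p' q' γ γ'} (hp : ∀ i < n, p i = p' i) (hq : ∀ i < n, q i = q' i)
    (hγ : ∀ i < n, γ i = γ' i) (h : Tn g n p q γ) : Tn g n p' q' γ' := by
  rcases Nat.eq_zero_or_pos n with rfl | hn
  · exact ⟨fun _ => p', by simp, by simp, fun j _ => Or.inl (by simp)⟩
  · obtain ⟨r, h0, h1, h2⟩ := h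
    rw [hγ 0 hn] at h1 h2
    exact ⟨r, fun i hi => (h0 i hi).trans (hp i hi), fun i hi => (h1 i hi).trans (hq i hi),
      fun j hj => (h2 j hj).mono fun i hi => (hγ _ hi).le⟩

theorem Tn.refl (g n p) {γ : ℕ → ℕ} (hγ : γ 0 = 0) : Tn g n p p γ :=
  ⟨fun _ => p, by simp, by simp, fun j hj => by omega⟩

theorem Tn.trans {g n p q w γ γ'} (h : Tn g n p q γ) (h' : Tn g n q w γ') :
    Tn g n p w (fun i => γ i + γ' i) := by
  obtain ⟨r, h0, h1, h2⟩ := h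
  obtain ⟨r', h0', h1', h2'⟩ := h'
  have key : ∀ j, γ 0 ≤ j → ∀ i < n,
      (if j ≤ γ 0 then r j else r' (j - γ 0)) i = r' (j - γ 0) i := by
    intro j hj i hi
    split_ifs with h
    · obtain rfl : j = γ 0 := by omega
      rw [Nat.sub_self, h1 i hi, h0' i hi]
    · rfl
  refine ⟨fun j => if j ≤ γ 0 then r j else r' (j - γ 0), ?_, ?_, ?_⟩
  · simpa using h0
  · intro i hi
    have := key (γ 0 + γ' 0) (by omega) i hi
    refine this.trans ?_
    rw [Nat.add_sub_cancel_left, h1' i hi]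
  · intro j hj
    dsimp only at hj
    rcases Nat.lt_or_ge j (γ 0) with hlt | hge
    · simp only [hlt.le, if_true, Nat.succ_le_of_lt hlt]
      exact (h2 j hlt).mono fun i _ => by simp
    · have := (h2' (j - γ 0) (by omega)).mono (γ' := fun i => γ i + γ' i) fun i _ => by simp
      refine this.congr (fun i hi => (key j hge i hi).symm) (fun i hi => ?_)
      rw [show j - γ 0 + 1 = j + 1 - γ 0 by omega]
      exact (key (j + 1) (by omega) i hi).symm

theorem Tn.of_mem {g p q} (h : p = q ∨ (p, q) ∈ Set.range g) : ∃ γ : ℕ → ℕ, ∀ n, Tn g n p q γ := by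
  have key : ∃ γ : ℕ → ℕ, γ 0 = 1 ∧ ∀ n, Dn g n p q γ := by
    rcases h with rfl | ⟨β, hβ⟩
    · exact ⟨fun _ => 1, rfl, fun n => Or.inl fun _ _ => rfl⟩
    · refine ⟨fun i => if i = 0 then 1 else β (i - 1), rfl, fun n => Or.inr ⟨β, ?_, ?_, ?_⟩⟩
      · intro i _; simp
      · simp [hβ]
      · simp [hβ]
  obtain ⟨γ, h0, hD⟩ := key
  refine ⟨γ, fun n => ⟨fun j => if j = 0 then p else q, by simp, by simp [h0], fun j hj => ?_⟩⟩
  obtain rfl : j = 0 := by omega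
  simpa using hD n

open Filter Topology in
theorem tendsto_of_agree {U : Filter ℕ} (hU : U ≤ cofinite) {Y : Type*} [TopologicalSpace Y]
    {a b : ℕ → ℕ → Y} {x : ℕ → Y} (ha : Tendsto a U (𝓝 x))
    (hab : ∀ᶠ n in U, ∀ i, i + 1 < n → a n i = b n i) : Tendsto b U (𝓝 x) := by
  rw [tendsto_pi_nhds] at ha ⊢
  intro i
  refine (ha i).congr' ?_
  have : ∀ᶠ n in U, i + 1 < n := by
    apply hU
    rw [Nat.cofinite_eq_atTop]
    exact eventually_gt_atTop _
  filter_upwards [hab, this] with n hn hi using hn i hi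

open Filter Topology in
theorem Dn.limit {g} (hg : Continuous g) {U : Ultrafilter ℕ} (hU : (U : Filter ℕ) ≤ cofinite)
    {a b : ℕ → ℕ → Bool} {p q : ℕ → Bool} (ha : Tendsto a U (𝓝 p)) (hb : Tendsto b U (𝓝 q)) {γ}
    (h : ∀ n, Dn g n (a n) (b n) γ) : p = q ∨ (p, q) ∈ Set.range g := by
  rcases Ultrafilter.eventually_or.1 (Eventually.of_forall (f := (U : Filter ℕ)) h) with h | h
  · left
    exact tendsto_nhds_unique
      (tendsto_of_agree hU ha (h.mono fun n hn i hi => hn i (by omega))) hb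
  · right
    have h' : ∀ n, ∃ β : ℕ → ℕ, (∃ β : ℕ → ℕ, (∀ i, i + 1 < n → β i ≤ γ (i + 1)) ∧
      (∀ i < n, (g β).1 i = a n i) ∧ (∀ i < n, (g β).2 i = b n i)) →
      (∀ i, i + 1 < n → β i ≤ γ (i + 1)) ∧
      (∀ i < n, (g β).1 i = a n i) ∧ (∀ i < n, (g β).2 i = b n i) := by
      intro n
      by_cases hn : ∃ β : ℕ → ℕ, (∀ i, i + 1 < n → β i ≤ γ (i + 1)) ∧
        (∀ i < n, (g β).1 i = a n i) ∧ (∀ i < n, (g β).2 i = b n i)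
      · exact ⟨hn.choose, fun _ => hn.choose_spec⟩
      · exact ⟨0, fun h => absurd h hn⟩
    choose β hβ using h'
    have hβ : ∀ᶠ n in (U : Filter ℕ), _ := h.mono fun n hn => hβ n hn
    let δ : ℕ → ℕ → ℕ := fun n i => min (β n i) (γ (i + 1))
    have hK : IsCompact (Set.Iic (fun i => γ (i + 1)) : Set (ℕ → ℕ)) := by
      rw [← Set.Icc_bot]; exact isCompact_Icc
    obtain ⟨ε, -, hε⟩ := hK.ultrafilter_le_nhds (U.map δ) (by
      rw [le_principal_iff]
      exact Eventually.of_forall (f := (U : Filter ℕ)) fun n i => min_le_right _ _)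
    have hε : Tendsto δ U (𝓝 ε) := hε
    have hβε : Tendsto β U (𝓝 ε) := tendsto_of_agree hU hε
      (hβ.mono fun n hn i hi => min_eq_left (hn.1 i hi))
    have hgl := (hg.tendsto ε).comp hβε
    refine ⟨ε, ?_⟩
    refine Prod.ext ?_ ?_
    · refine tendsto_nhds_unique (tendsto_of_agree hU
        ((continuous_fst.tendsto _).comp hgl) ?_) ha
      exact hβ.mono fun n hn i hi => hn.2.1 i (by omega)
    · refine tendsto_nhds_unique (tendsto_of_agree hU
        ((continuous_snd.tendsto _).comp hgl) ?_) hb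
      exact hβ.mono fun n hn i hi => hn.2.2 i (by omega)

open Filter Topology in
theorem Tn.mem {g} (hg : Continuous g)
    (htr : ∀ p q w, (p, q) ∈ Set.range g → (q, w) ∈ Set.range g → (p, w) ∈ Set.range g)
    {p q γ} (h : ∀ n, Tn g n p q γ) : p = q ∨ (p, q) ∈ Set.range g := by
  choose r h0 h1 h2 using h
  let U : Ultrafilter ℕ := hyperfilter ℕ
  have hU : (U : Filter ℕ) ≤ cofinite := hyperfilter_le_cofinite
  obtain ⟨l, -, hl⟩ := (isCompact_univ (X := ℕ → ℕ → Bool)).ultrafilter_le_nhds (U.map r) (by simp)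
  have hl : Tendsto r U (𝓝 l) := hl
  have hl' : ∀ j, Tendsto (fun n => r n j) U (𝓝 (l j)) := tendsto_pi_nhds.1 hl
  have e0 : l 0 = p := tendsto_nhds_unique (tendsto_of_agree hU (hl' 0)
    (Eventually.of_forall fun n i hi => h0 n i (by omega))) tendsto_const_nhds
  have e1 : l (γ 0) = q := tendsto_nhds_unique (tendsto_of_agree hU (hl' (γ 0))
    (Eventually.of_forall fun n i hi => h1 n i (by omega))) tendsto_const_nhds
  have hstep : ∀ j < γ 0, l j = l (j + 1) ∨ (l j, l (j + 1)) ∈ Set.range g := fun j hj =>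
    Dn.limit hg hU (hl' j) (hl' (j + 1)) (γ := γ) fun n => h2 n j hj
  have : ∀ j ≤ γ 0, l 0 = l j ∨ (l 0, l j) ∈ Set.range g := by
    intro j
    induction j with
    | zero => intro _; exact Or.inl rfl
    | succ j ih =>
      intro hj
      rcases ih (by omega) with h | h <;> rcases hstep j (by omega) with h' | h'
      · exact Or.inl (h.trans h')
      · right; rw [h]; exact h'
      · right; rw [← h']; exact h
      · exact Or.inr (htr _ _ _ h h')
  rw [← e0, ← e1]
  exact this _ le_rfl

/-- The activation predicate. -/
def Act (g : (ℕ → ℕ) → (ℕ → Bool) × (ℕ → Bool)) (x : ℕ → Bool) (u : List Bool) (s : List ℕ) : Prop :=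
  Tn g s.length (fun i => u.getD i false) x (val s)

theorem main_iff {g} (hg : Continuous g)
    (htr : ∀ p q w, (p, q) ∈ Set.range g → (q, w) ∈ Set.range g → (p, w) ∈ Set.range g)
    (x y : ℕ → Bool) : (x = y ∨ (x, y) ∈ Set.range g) ↔
      ∃ F : Vtx → Vtx, Function.Injective F ∧
        ∀ v w, Edge (Act g x) v w ↔ Edge (Act g y) (F v) (F w) := by
  constructor
  · intro h
    obtain ⟨γ, hγ⟩ := Tn.of_mem h
    refine ⟨fwd (Act g x) γ, fwd_inj _ _, fwd_edge _ _ _ fun u s hus => ?_⟩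
    unfold Act at hus ⊢
    rw [shift_length]
    exact (hus.trans (hγ _)).congr (fun _ _ => rfl) (fun _ _ => rfl)
      fun i hi => (val_shift γ s i hi).symm
  · rintro ⟨F, hF, hE⟩
    obtain ⟨γ, hγ⟩ := bwd F hF hE
    refine Tn.mem hg htr (γ := γ) fun n => ?_
    obtain ⟨t, ht, hv, hA⟩ := hγ n
    have key : ∀ i < n, ((List.range n).map x).getD i false = x i := by
      intro i hi
      simp [List.getD, hi]
    have h1 : Act g x ((List.range n).map x) (List.replicate n 0) := by
      unfold Act
      rw [List.length_replicate]
      exact (Tn.refl g n x (val_replicate n 0)).congr (fun i hi => (key i hi).symm)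
        (fun _ _ => rfl) (fun _ _ => rfl)
    have h2 := hA _ h1
    unfold Act at h2
    rw [ht] at h2
    exact h2.congr key (fun _ _ => rfl) hv

theorem measurable_act (g u s) : MeasurableSet {x | Act g x u s} := by
  apply IsOpen.measurableSet
  rw [isOpen_iff_forall_mem_open]
  intro x hx
  refine ⟨PiNat.cylinder x s.length, ?_, PiNat.isOpen_cylinder _ _ _, PiNat.self_mem_cylinder _ _⟩
  intro y hy
  rw [PiNat.mem_cylinder_iff] at hy
  exact Tn.congr (fun _ _ => rfl) (fun i hi => (hy i hi).symm) (fun _ _ => rfl) hx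

theorem measurable_edge (g) (v w : Vtx) : MeasurableSet {x | Edge (Act g x) v w} := by
  cases v <;> cases w <;> simp only [Edge] <;>
    first
    | exact MeasurableSet.const _
    | exact (measurable_act g _ _).inter (MeasurableSet.const _)

instance : Countable Vtx := by
  let f : Vtx → (ℕ ⊕ List ℕ) ⊕ ((List Bool × List ℕ) ⊕ ℕ)
    | .c n => .inl (.inl n)
    | .nd s => .inl (.inr s)
    | .gd u s => .inr (.inl (u, s))
    | .sp n => .inr (.inr n)
  refine Function.Injective.countable (f := f) ?_
  intro v w h
  cases v <;> cases w <;> simp_all [f]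

instance : Infinite Vtx := Infinite.of_injective Vtx.c fun a b h => by simpa using h

open Classical in
/-- The coding graph transported to `ℕ`. -/
noncomputable def toGr (e : ℕ ≃ Vtx) (A : List Bool → List ℕ → Prop) : XGr :=
  ⟨fun p => decide (Edge A (e p.1) (e p.2)),
    fun a b => by
      simp only [decide_eq_decide]
      exact ⟨Edge.symm _ _, Edge.symm _ _⟩,
    fun a => by simpa using Edge.irrefl _⟩

theorem toGr_embeds (e : ℕ ≃ Vtx) (A B) : GrEmbeds (toGr e A) (toGr e B) ↔
    ∃ F : Vtx → Vtx, Function.Injective F ∧ ∀ v w, Edge A v w ↔ Edge B (F v) (F w) := by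
  simp only [GrEmbeds, toGr, decide_eq_true_eq]
  constructor
  · rintro ⟨f, hf, h⟩
    refine ⟨fun v => e (f (e.symm v)), e.injective.comp (hf.comp e.symm.injective), fun v w => ?_⟩
    have := h (e.symm v) (e.symm w)
    simpa using this
  · rintro ⟨F, hF, h⟩
    refine ⟨fun n => e.symm (F (e n)), e.symm.injective.comp (hF.comp e.injective), fun m n => ?_⟩
    simpa using h (e m) (e n)

open MeasureTheory in
theorem reducible (X : Type*) [MeasurableSpace X] [StandardBorelSpace X] (R : X → X → Prop)
    (hR : IsQuasiOrder R) (hA : IsAnalyticRel R) : BorelReducible R GrEmbeds := by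
  obtain ⟨e⟩ : Nonempty (ℕ ≃ Vtx) := nonempty_equiv_of_countable
  obtain ⟨j, hj, hji⟩ := MeasurableSpace.measurable_injection_nat_bool_of_countablySeparated X
  rcases hA with hA | ⟨f, hf, hfr⟩
  · have hX : IsEmpty X := ⟨fun x => by
      have : (x, x) ∈ {p : X × X | R p.1 p.2} := hR.1 x
      rw [hA] at this
      exact this⟩
    exact ⟨fun x => isEmptyElim x, measurable_of_empty _, fun x => isEmptyElim x⟩
  · have hm : Measurable fun α => (Prod.map j j (f α)) := (hj.prodMap hj).comp hf
    have han := MeasurableSet.univ.analyticSet_image hm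
    rw [Set.image_univ, AnalyticSet] at han
    rcases han with h | ⟨g, hg, hgr⟩
    · exact absurd h (Set.range_nonempty _).ne_empty
    · have hmem : ∀ p q, (p, q) ∈ Set.range g ↔ ∃ x y, R x y ∧ j x = p ∧ j y = q := by
        intro p q
        rw [hgr]
        constructor
        · rintro ⟨α, hα⟩
          have : f α ∈ {p : X × X | R p.1 p.2} := hfr ▸ ⟨α, rfl⟩
          exact ⟨_, _, this, congrArg Prod.fst hα, congrArg Prod.snd hα⟩
        · rintro ⟨x, y, h, rfl, rfl⟩
          have : (x, y) ∈ Set.range f := by rw [hfr]; exact h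
          obtain ⟨α, hα⟩ := this
          exact ⟨α, by simp [hα]⟩
      have htr : ∀ p q w, (p, q) ∈ Set.range g → (q, w) ∈ Set.range g → (p, w) ∈ Set.range g := by
        intro p q w
        simp only [hmem]
        rintro ⟨x, y, h, rfl, rfl⟩ ⟨y', z, h', hy, rfl⟩
        rw [hji hy] at h'
        exact ⟨x, z, hR.2 h h', rfl, rfl⟩
      refine ⟨fun x => toGr e (Act g (j x)), ?_, fun x y => ?_⟩
      · refine Measurable.subtype_mk (measurable_pi_lambda _ fun p => ?_)
        refine measurable_to_bool ?_
        have := hj (measurable_edge g (e p.1) (e p.2))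
        convert this using 1
        ext x
        simp
      · rw [toGr_embeds, ← main_iff hg htr, hmem]
        constructor
        · exact fun h => Or.inr ⟨x, y, h, rfl, rfl⟩
        · rintro (h | ⟨x', y', h, hx, hy⟩)
          · rw [hji h]; exact hR.1 y
          · rw [hji hx, hji hy] at h; exact h

end LR

open Filter Topology MeasureTheory in
theorem grEmbeds_analytic : IsAnalyticRel GrEmbeds := by
  have hcl : IsClosed {A : ℕ × ℕ → Bool | (∀ a b, A (a, b) = A (b, a)) ∧ ∀ a, A (a, a) = false} := by
    simp only [Set.setOf_and, Set.setOf_forall]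
    refine IsClosed.inter ?_ ?_
    · exact isClosed_iInter fun a => isClosed_iInter fun b =>
        isClosed_eq (continuous_apply _) (continuous_apply _)
    · exact isClosed_iInter fun a => isClosed_eq (continuous_apply _) continuous_const
  have : PolishSpace (ℕ × ℕ → Bool) := {}
  have : PolishSpace XGr := hcl.polishSpace
  let S : Set ((XGr × XGr) × (ℕ → ℕ)) := {p | Function.Injective p.2 ∧
    ∀ m n, p.1.1.1 (m, n) = true ↔ p.1.2.1 (p.2 m, p.2 n) = true}
  have hS : MeasurableSet S := by
    have : S = {p | (∀ m n, p.2 m = p.2 n → m = n) ∧ ∀ m n a b, p.2 m = a → p.2 n = b →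
        p.1.1.1 (m, n) = p.1.2.1 (a, b)} := by
      ext p
      simp only [S, Set.mem_setOf_eq, Function.Injective]
      refine and_congr Iff.rfl ?_
      constructor
      · rintro h m n a b rfl rfl
        exact Bool.eq_iff_iff.2 (h m n)
      · intro h m n
        exact Bool.eq_iff_iff.1 (h m n _ _ rfl rfl)
    rw [this]
    have e2 : ∀ m, Measurable fun p : (XGr × XGr) × (ℕ → ℕ) => p.2 m := fun m =>
      (measurable_pi_apply m).comp measurable_snd
    have e1 : ∀ q, Measurable fun p : (XGr × XGr) × (ℕ → ℕ) => p.1.1.1 q := fun q =>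
      (measurable_pi_apply q).comp (measurable_subtype_coe.comp (measurable_fst.comp measurable_fst))
    have e3 : ∀ q, Measurable fun p : (XGr × XGr) × (ℕ → ℕ) => p.1.2.1 q := fun q =>
      (measurable_pi_apply q).comp (measurable_subtype_coe.comp (measurable_snd.comp measurable_fst))
    simp only [Set.setOf_and, Set.setOf_forall]
    refine MeasurableSet.inter ?_ ?_
    · refine MeasurableSet.iInter fun m => MeasurableSet.iInter fun n => ?_
      exact (measurableSet_eq_fun (e2 m) (e2 n)).imp (MeasurableSet.const _)
    · refine MeasurableSet.iInter fun m => MeasurableSet.iInter fun n => MeasurableSet.iInter fun a =>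
        MeasurableSet.iInter fun b => ?_
      exact (measurableSet_eq_fun (e2 m) measurable_const).imp
        ((measurableSet_eq_fun (e2 n) measurable_const).imp (measurableSet_eq_fun (e1 _) (e3 _)))
  have hA := hS.analyticSet_image (f := Prod.fst) measurable_fst
  have hEq : Prod.fst '' S = {p : XGr × XGr | GrEmbeds p.1 p.2} := by
    ext p
    constructor
    · rintro ⟨q, hq, rfl⟩; exact ⟨q.2, hq⟩
    · rintro ⟨f, hf⟩; exact ⟨(p, f), hf, rfl⟩
  rw [hEq, AnalyticSet] at hA
  rcases hA with h | ⟨f, hf, h⟩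
  · exact Or.inl h
  · exact Or.inr ⟨f, hf.measurable, h⟩

theorem grEmbeds_qo : IsQuasiOrder GrEmbeds := by
  constructor
  · exact fun T => ⟨id, Function.injective_id, fun _ _ => Iff.rfl⟩
  · rintro T S U ⟨f, hf, hf'⟩ ⟨g, hg, hg'⟩
    exact ⟨g ∘ f, hg.comp hf, fun m n => (hf' m n).trans (hg' _ _)⟩

/-- **Completeness of embeddability between countable graphs.**
`⊑_Gr` is an analytic quasi-order on `X_Gr`, and every analytic quasi-order `R` on a
standard Borel space `X` is Borel reducible to it. -/
theorem grEmbeds_complete_analytic_quasiOrder :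
    IsQuasiOrder GrEmbeds ∧ IsAnalyticRel GrEmbeds ∧
      ∀ (X : Type*) [MeasurableSpace X] [StandardBorelSpace X] (R : X → X → Prop),
        IsQuasiOrder R → IsAnalyticRel R → BorelReducible R GrEmbeds := by
  exact ⟨grEmbeds_qo, grEmbeds_analytic, fun X _ _ R => LR.reducible X R⟩
end
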